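/- For all ε, δ, η ∈ (0,1/2) and every integer k ≥ 3, there exists C > 0 such that the following holds for every positive integer N, every p ∈ (0,1/2), and all positive integers t and m with t ≥ C·max{m, m·N·p^{k−1}, m²·p^{k−2}·N^{C·(m/t)^{1/(k−1)}}}. Writing C(s) for the set of (t, ε, δ·β(s/m))-cores of size s, one has |C(s)| ≤ (η/p)^s whenever s ≤ m, and |C(s)| ≤ (1/p)^{η·s} whenever s ≤ min{m, √(4kt)·log(1/p)}. -/

import Mathlib

open Finset Filter
open scoped Classical BigOperators

noncomputable section

/-- The set of `k`-term arithmetic progressions in `{1, …, N}`: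
`k`-element subsets of the form `{a, a+b, …, a+(k-1)b}` with `a, b` positive integers. -/
def apSet (k N : ℕ) : Finset (Finset ℕ) :=
  ((Finset.Icc 1 N).powerset).filter fun B =>
    ∃ a b : ℕ, 0 < a ∧ 0 < b ∧ B = (Finset.range k).image fun i => a + i * b


/-- `A_r(U)`: the number of `k`-term arithmetic progressions in `{1,…,N}`
intersecting `U` in exactly `r` elements. -/
def Ar (k N r : ℕ) (U : Finset ℕ) : ℝ :=
  (((apSet k N).filter fun B => (B ∩ U).card = r).card : ℝ)

/-- `A_k(U)`: the number of `k`-term arithmetic progressions contained in `U`. -/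
def numAPin (k N : ℕ) (U : Finset ℕ) : ℝ := (((apSet k N).filter fun B => B ⊆ U).card : ℝ)

/-- `Ψ*(t)`: the least cardinality of a set `U ⊆ {1,…,N}` with `A_k(U) ≥ t`
(`⊤` if no such set exists). -/
def apPsiStar (k N : ℕ) (t : ℝ) : ℕ∞ :=
  sInf {n : ℕ∞ | ∃ U : Finset ℕ, U ⊆ Finset.Icc 1 N ∧ t ≤ numAPin k N U ∧ (U.card : ℕ∞) = n}

/-- `β(x) = 1/(2 − log x)²`. -/
def betaFn (x : ℝ) : ℝ := 1 / (2 - Real.log x) ^ 2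

/-- A set `U* ⊆ {1,…,N}` is a `(t,ε,ξ)`-core if `|U*| ≥ Ψ*((1−ε)t)` and there is
`r ∈ {3,…,k}` such that `∂_u A_r(U*) ≥ (ξ/|U*|)·max{t, (t/|U*|²)^{1/(k−2)}·max_{K⊆U*} A_{r−1}(K)}`
for every `u ∈ U*`. -/
def IsCore (k N : ℕ) (t ε ξ : ℝ) (Us : Finset ℕ) : Prop :=
  Us ⊆ Finset.Icc 1 N ∧
  apPsiStar k N ((1 - ε) * t) ≤ (Us.card : ℕ∞) ∧
  ∃ r : ℕ, 3 ≤ r ∧ r ≤ k ∧ ∀ u ∈ Us,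
    ξ / (Us.card : ℝ) *
        max t ((t / (Us.card : ℝ) ^ 2) ^ ((1 : ℝ) / ((k : ℝ) - 2)) *
          Us.powerset.sup' (Finset.powerset_nonempty Us) (Ar k N (r - 1))) ≤
      Ar k N r (insert u Us) - Ar k N r (Us.erase u)

/-- The collection of `(t, ε, δ·β(s/m))`-cores of size `s`. -/
def coreFamily (k N : ℕ) (t ε δ : ℝ) (m s : ℕ) : Finset (Finset ℕ) :=
  ((Finset.Icc 1 N).powerset).filter fun Us =>
    Us.card = s ∧ IsCore k N t ε (δ * betaFn ((s : ℝ) / (m : ℝ))) Us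

theorem sum_powersetCard_succ_erase (U : Finset ℕ) (j : ℕ) (g : Finset ℕ → ℕ → ℝ) :
    ∑ K ∈ powersetCard (j + 1) U, ∑ u ∈ K, g (K.erase u) u =
      ∑ u ∈ U, ∑ K ∈ powersetCard j (U.erase u), g K u := by
  rw [Finset.sum_comm' (t' := U) (s' := fun u => (powersetCard (j + 1) U).filter (u ∈ ·))]
  · refine Finset.sum_congr rfl fun u hu => ?_
    refine Finset.sum_bij' (fun K _ => K.erase u) (fun K _ => insert u K) ?_ ?_ ?_ ?_ ?_
    · intro K hK
      simp only [mem_filter, mem_powersetCard] at hK ⊢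
      exact ⟨Finset.erase_subset_erase _ hK.1.1, by rw [card_erase_of_mem hK.2, hK.1.2]; rfl⟩
    · intro K hK
      simp only [mem_filter, mem_powersetCard] at hK ⊢
      have hn : u ∉ K := fun h => by simpa using hK.1 h
      refine ⟨⟨?_, by rw [card_insert_of_notMem hn, hK.2]⟩, mem_insert_self _ _⟩
      exact insert_subset hu (hK.1.trans (erase_subset _ _))
    · intro K hK
      simp only [mem_filter] at hK
      exact insert_erase hK.2
    · intro K hK
      simp only [mem_powersetCard] at hK
      exact erase_insert fun h => by simpa using hK.1 h
    · intro K _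
      rfl
  · intro K u
    simp only [mem_filter, mem_powersetCard]
    exact ⟨fun h => ⟨⟨h.1, h.2⟩, h.1.1 h.2⟩, fun h => ⟨h.1.1, h.1.2⟩⟩

theorem sum_powersetCard_sdiff (U : Finset ℕ) (j : ℕ) (g : Finset ℕ → ℕ → ℝ) :
    ∑ K ∈ powersetCard j U, ∑ u ∈ U \ K, g K u =
      ∑ u ∈ U, ∑ K ∈ powersetCard j (U.erase u), g K u := by
  refine Finset.sum_comm' fun K u => ?_
  simp only [mem_powersetCard, Finset.mem_sdiff, subset_erase]
  tauto

/-- Total weight of the orderings of the `j`-element set `K`, where appending `u` to an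
ordered set with underlying set `L` has weight `w L u`. -/
def orderingWeight (w : Finset ℕ → ℕ → ℝ) : ℕ → Finset ℕ → ℝ
  | 0, _ => 1
  | j + 1, K => ∑ u ∈ K, orderingWeight w j (K.erase u) * w (K.erase u) u

theorem orderingWeight_nonneg {w : Finset ℕ → ℕ → ℝ} (hw : ∀ K u, 0 ≤ w K u) (j : ℕ)
    (K : Finset ℕ) : 0 ≤ orderingWeight w j K := by
  induction j generalizing K with
  | zero => simp [orderingWeight]
  | succ j ih => exact Finset.sum_nonneg fun u _ => mul_nonneg (ih _) (hw _ _)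

theorem orderingWeight_pos {w : Finset ℕ → ℕ → ℝ} (hw : ∀ K u, 0 < w K u) (j : ℕ)
    (K : Finset ℕ) (hK : K.card = j) : 0 < orderingWeight w j K := by
  induction j generalizing K with
  | zero => simp [orderingWeight]
  | succ j ih =>
    refine Finset.sum_pos (fun u hu => mul_pos (ih _ ?_) (hw _ _)) ?_
    · rw [card_erase_of_mem hu, hK]; rfl
    · exact Finset.card_pos.1 (by omega)

theorem sum_orderingWeight_le_one {w : Finset ℕ → ℕ → ℝ} (hw : ∀ K u, 0 ≤ w K u)
    {G : Finset ℕ} (hG : ∀ K, ∑ u ∈ G, w K u ≤ 1) (j : ℕ) :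
    ∑ K ∈ powersetCard j G, orderingWeight w j K ≤ 1 := by
  induction j with
  | zero => simp [orderingWeight]
  | succ j ih =>
    simp only [orderingWeight]
    rw [sum_powersetCard_succ_erase G j fun K u => orderingWeight w j K * w K u,
      ← sum_powersetCard_sdiff]
    refine le_trans (Finset.sum_le_sum fun K _ => ?_) ih
    rw [← Finset.mul_sum]
    refine mul_le_of_le_one_right (orderingWeight_nonneg hw _ _) ?_
    exact (Finset.sum_le_sum_of_subset_of_nonneg sdiff_subset fun u _ _ => hw _ _).trans (hG K)

theorem succ_mul_choose_real {s j : ℕ} (hj : j < s) :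
    ((j : ℝ) + 1) * (s.choose (j + 1) : ℝ) = (s : ℝ) * ((s - 1).choose j : ℝ) ∧
      ((s : ℝ) - j) * (s.choose j : ℝ) = (s : ℝ) * ((s - 1).choose j : ℝ) := by
  obtain ⟨n, rfl⟩ : ∃ n, s = n + 1 := ⟨s - 1, by omega⟩
  have h1 := Nat.add_one_mul_choose_eq n j
  have h2 := Nat.choose_mul_succ_eq n j
  have h3 : ((n + 1 - j : ℕ) : ℝ) = ((n + 1 : ℕ) : ℝ) - j := by
    rw [Nat.cast_sub hj.le]
  constructor
  · have : ((n : ℝ) + 1) * (n.choose j : ℝ) = ((n + 1).choose (j + 1) : ℝ) * ((j : ℝ) + 1) := by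
      exact_mod_cast h1
    simp only [Nat.add_sub_cancel]
    push_cast
    linarith
  · have h4 : (n.choose j : ℝ) * ((n : ℝ) + 1) =
        ((n + 1).choose j : ℝ) * ((n + 1 - j : ℕ) : ℝ) := by
      exact_mod_cast h2
    rw [h3] at h4
    simp only [Nat.add_sub_cancel]
    push_cast at h4 ⊢
    linarith

theorem sum_log_orderingWeight_ge {w : Finset ℕ → ℕ → ℝ} (hw : ∀ K u, 0 < w K u)
    {U : Finset ℕ} {s : ℕ} (hU : U.card = s) (l : ℕ → ℝ)
    (hl : ∀ j < s, (s : ℝ) * ((s - 1).choose j : ℝ) * l j ≤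
      ∑ u ∈ U, ∑ K ∈ powersetCard j (U.erase u), Real.log (w K u))
    (j : ℕ) (hj : j ≤ s) :
    (s.choose j : ℝ) * ∑ i ∈ range j, l i ≤
      ∑ K ∈ powersetCard j U, Real.log (orderingWeight w j K / (j.factorial : ℝ)) := by
  induction j with
  | zero => simp [orderingWeight]
  | succ j ih =>
    have ih := ih (by omega)
    have hjs : j < s := by omega
    obtain ⟨e1, e2⟩ := succ_mul_choose_real hjs
    have hj0 : (0 : ℝ) < (j : ℝ) + 1 := by positivity
    have jensen : ∀ K ∈ powersetCard (j + 1) U,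
        ∑ u ∈ K, (Real.log (orderingWeight w j (K.erase u) / (j.factorial : ℝ)) +
          Real.log (w (K.erase u) u)) ≤
        ((j : ℝ) + 1) * Real.log (orderingWeight w (j + 1) K / ((j + 1).factorial : ℝ)) := by
      intro K hK
      rw [mem_powersetCard] at hK
      have hpos : ∀ u ∈ K, 0 < orderingWeight w j (K.erase u) / (j.factorial : ℝ) := by
        intro u hu
        have := orderingWeight_pos hw j (K.erase u) (by rw [card_erase_of_mem hu, hK.2]; rfl)
        positivity
      have := strictConcaveOn_log_Ioi.concaveOn.le_map_sum (t := K)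
        (w := fun _ => 1 / ((j : ℝ) + 1))
        (p := fun u => orderingWeight w j (K.erase u) / (j.factorial : ℝ) * w (K.erase u) u)
        (fun _ _ => by positivity)
        (by rw [Finset.sum_const, hK.2]; simp; field_simp)
        (fun u hu => mul_pos (hpos u hu) (hw _ _))
      simp only [smul_eq_mul] at this
      rw [← Finset.mul_sum, ← Finset.mul_sum] at this
      have e : 1 / ((j : ℝ) + 1) *
          ∑ u ∈ K, orderingWeight w j (K.erase u) / (j.factorial : ℝ) * w (K.erase u) u =
          orderingWeight w (j + 1) K / ((j + 1).factorial : ℝ) := by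
        simp only [orderingWeight, Nat.factorial_succ]
        rw [Finset.mul_sum, Finset.sum_div]
        refine Finset.sum_congr rfl fun u _ => ?_
        push_cast
        field_simp
      rw [e, one_div, inv_mul_le_iff₀ hj0] at this
      refine le_trans (le_of_eq (Finset.sum_congr rfl fun u hu => ?_)) this
      rw [Real.log_mul (hpos u hu).ne' (hw _ _).ne']
    have h := Finset.sum_le_sum jensen
    rw [sum_powersetCard_succ_erase U j fun K u =>
      Real.log (orderingWeight w j K / (j.factorial : ℝ)) + Real.log (w K u)] at h
    simp only [Finset.sum_add_distrib] at h
    rw [← sum_powersetCard_sdiff U j fun K u =>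
      Real.log (orderingWeight w j K / (j.factorial : ℝ)), ← Finset.mul_sum] at h
    have h5 : ∑ K ∈ powersetCard j U, ∑ _u ∈ U \ K,
        Real.log (orderingWeight w j K / (j.factorial : ℝ)) =
        ((s : ℝ) - j) * ∑ K ∈ powersetCard j U,
          Real.log (orderingWeight w j K / (j.factorial : ℝ)) := by
      rw [Finset.mul_sum]
      refine Finset.sum_congr rfl fun K hK => ?_
      rw [mem_powersetCard] at hK
      rw [Finset.sum_const, card_sdiff_of_subset hK.1, hU, hK.2, nsmul_eq_mul, Nat.cast_sub hjs.le]
    rw [h5] at h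
    have h6 := hl j hjs
    have h7 : (0 : ℝ) ≤ (s : ℝ) - j := by
      rw [sub_nonneg]; exact_mod_cast hjs.le
    have h8 := mul_le_mul_of_nonneg_left ih h7
    refine le_of_mul_le_mul_left ?_ hj0
    have h9 : ((j : ℝ) + 1) * ((s.choose (j + 1) : ℝ) * ∑ i ∈ range (j + 1), l i) =
        ((s : ℝ) - j) * ((s.choose j : ℝ) * ∑ i ∈ range j, l i) +
          (s : ℝ) * ((s - 1).choose j : ℝ) * l j := by
      rw [Finset.sum_range_succ]
      linear_combination (∑ i ∈ range j, l i + l j) * e1 - (∑ i ∈ range j, l i) * e2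
    linarith

theorem card_mul_exp_le_one {w : Finset ℕ → ℕ → ℝ} (hw : ∀ K u, 0 < w K u)
    {G : Finset ℕ} (hG : ∀ K, ∑ u ∈ G, w K u ≤ 1) {s : ℕ} (l : ℕ → ℝ)
    {𝒞 : Finset (Finset ℕ)} (h𝒞 : 𝒞 ⊆ powersetCard s G)
    (hl : ∀ U ∈ 𝒞, ∀ j < s, (s : ℝ) * ((s - 1).choose j : ℝ) * l j ≤
      ∑ u ∈ U, ∑ K ∈ powersetCard j (U.erase u), Real.log (w K u)) :
    (𝒞.card : ℝ) * ((s.factorial : ℝ) * Real.exp (∑ j ∈ range s, l j)) ≤ 1 := by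
  have hw0 : ∀ K u, 0 ≤ w K u := fun K u => (hw K u).le
  refine le_trans ?_ (sum_orderingWeight_le_one hw0 hG s)
  refine le_trans ?_ (Finset.sum_le_sum_of_subset_of_nonneg h𝒞 fun K _ _ =>
    orderingWeight_nonneg hw0 s K)
  rw [← nsmul_eq_mul]
  refine Finset.card_nsmul_le_sum _ _ _ fun U hU => ?_
  have hc : U.card = s := (mem_powersetCard.1 (h𝒞 hU)).2
  have := sum_log_orderingWeight_ge hw hc l (hl U hU) s le_rfl
  have hp := orderingWeight_pos hw s U hc
  have hf : (0 : ℝ) < (s.factorial : ℝ) := by positivity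
  have hs : powersetCard s U = {U} := by rw [← hc, powersetCard_self]
  rw [hs, Finset.sum_singleton, Nat.choose_self, Nat.cast_one, one_mul,
    Real.le_log_iff_exp_le (by positivity), le_div_iff₀ hf] at this
  linarith

theorem card_supersets_eq {V R : Finset ℕ} {j : ℕ} (hR : R ⊆ V) (hj : R.card ≤ j)
    (hjn : j ≤ V.card) :
    (((powersetCard j V).filter (R ⊆ ·)).card : ℝ) =
      (V.card.choose j : ℝ) * ∏ i ∈ range R.card, (((j : ℝ) - i) / ((V.card : ℝ) - i)) := by
  rw [card_filter_powersetCard_subset R V j hR hj]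
  generalize R.card = b at *
  generalize V.card = n at *
  clear hR
  induction b with
  | zero => simp
  | succ b ih =>
    have ih := ih (by omega)
    rw [Finset.prod_range_succ, ← mul_assoc, ← ih]
    have hb : (0 : ℝ) < (n : ℝ) - b := by
      rw [sub_pos]; exact_mod_cast (by omega : b < n)
    obtain ⟨n', hn'⟩ : ∃ n', n - b = n' + 1 := ⟨n - b - 1, by omega⟩
    obtain ⟨j', hj'⟩ : ∃ j', j - b = j' + 1 := ⟨j - b - 1, by omega⟩
    have e := Nat.add_one_mul_choose_eq n' j'
    rw [show n - (b + 1) = n' by omega, show j - (b + 1) = j' by omega, hn', hj']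
    have e1 : ((n : ℝ) - b) = (n' : ℝ) + 1 := by
      rw [← Nat.cast_sub (by omega), hn']; push_cast; rfl
    have e2 : ((j : ℝ) - b) = (j' : ℝ) + 1 := by
      rw [← Nat.cast_sub (by omega), hj']; push_cast; rfl
    rw [e1, e2]
    have e3 : ((n' : ℝ) + 1) * (n'.choose j' : ℝ) =
      ((n' + 1).choose (j' + 1) : ℝ) * ((j' : ℝ) + 1) := by exact_mod_cast e
    field_simp
    linarith

/-- The probability that a random `j`-subset of an `n`-set contains a fixed `a`-subset. -/
def inclProb (n j a : ℕ) : ℝ := ∏ i ∈ range a, (((j : ℝ) - i) / ((n : ℝ) - i))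

theorem inclProb_nonneg {n j a : ℕ} (ha : a ≤ j) (hj : j ≤ n) : 0 ≤ inclProb n j a := by
  refine Finset.prod_nonneg fun i hi => ?_
  rw [mem_range] at hi
  have : (i : ℝ) ≤ j := by exact_mod_cast (by omega : i ≤ j)
  have : (j : ℝ) ≤ n := by exact_mod_cast hj
  exact div_nonneg (by linarith) (by linarith)

theorem inclProb_add_self_le {n j a : ℕ} (ha : a + a ≤ j) (hj : j ≤ n) :
    inclProb n j (a + a) ≤ inclProb n j a ^ 2 := by
  rw [sq, inclProb, Finset.prod_range_add]
  refine mul_le_mul_of_nonneg_left ?_ (inclProb_nonneg (by omega) hj)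
  have hjn : (j : ℝ) ≤ n := by exact_mod_cast hj
  refine Finset.prod_le_prod (fun i hi => ?_) fun i hi => ?_
  · rw [mem_range] at hi
    have : ((a + i : ℕ) : ℝ) ≤ j := by exact_mod_cast (by omega : a + i ≤ j)
    exact div_nonneg (by linarith) (by linarith)
  · rw [mem_range] at hi
    have h : ((a + i : ℕ) : ℝ) < j := by exact_mod_cast (by omega : a + i < j)
    have h0 : (0 : ℝ) ≤ a := by positivity
    push_cast at h ⊢
    rw [div_le_div_iff₀ (by linarith) (by linarith)]
    nlinarith

theorem le_inclProb {n j a : ℕ} (ha : a + a ≤ j) (hj : j ≤ n) :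
    (((j : ℝ) + 1) / (2 * ((n : ℝ) + 1))) ^ a ≤ inclProb n j a := by
  have hjn : (j : ℝ) ≤ n := by exact_mod_cast hj
  have e : (((j : ℝ) + 1) / (2 * ((n : ℝ) + 1))) ^ a =
    ∏ _i ∈ range a, (((j : ℝ) + 1) / (2 * ((n : ℝ) + 1))) := by
    rw [Finset.prod_const, card_range]
  rw [e]
  refine Finset.prod_le_prod (fun i hi => by positivity) fun i hi => ?_
  rw [mem_range] at hi
  have h : 2 * (i : ℝ) + 2 ≤ j := by exact_mod_cast (by omega : 2 * i + 2 ≤ j)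
  have h0 : (0 : ℝ) ≤ i := by positivity
  rw [div_le_div_iff₀ (by linarith) (by linarith)]
  nlinarith

theorem card_filter_subset_eq {V R : Finset ℕ} {j a : ℕ} (hR : R ⊆ V) (ha : R.card = a)
    (hj : a ≤ j) (hjn : j ≤ V.card) :
    (((powersetCard j V).filter (R ⊆ ·)).card : ℝ) =
      (V.card.choose j : ℝ) * inclProb V.card j a := by
  rw [card_supersets_eq hR (by omega) hjn, inclProb, ha]

/-- Chebyshev's inequality for the number of sets of a sparse family lying in a random
`j`-subset. -/
theorem card_few_traces_le {ι : Type*} {V : Finset ℕ} {j a : ℕ} (hj : a + a ≤ j)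
    (hjn : j ≤ V.card) (F : Finset ι) (R : ι → Finset ℕ) (hR : ∀ B ∈ F, R B ⊆ V)
    (hRa : ∀ B ∈ F, (R B).card = a) {Δ : ℝ}
    (hΔ0 : 0 ≤ Δ) (hΔ : ∀ B ∈ F, ((F.filter fun B' => ¬ Disjoint (R B) (R B')).card : ℝ) ≤ Δ) :
    (((powersetCard j V).filter fun K =>
        ((F.filter fun B => R B ⊆ K).card : ℝ) < F.card * inclProb V.card j a / 2).card : ℝ) *
      (F.card * inclProb V.card j a) ≤ 4 * Δ * (V.card.choose j : ℝ) := by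
  set q := inclProb V.card j a with hq
  set c : ℝ := (V.card.choose j : ℝ) with hc
  have hq0 : 0 ≤ q := inclProb_nonneg (by omega) hjn
  have hc0 : 0 ≤ c := by positivity
  set μ : ℝ := F.card * q with hμ
  set X : Finset ℕ → ℝ := fun K => ((F.filter fun B => R B ⊆ K).card : ℝ) with hX
  have hXs : ∀ K, X K = ∑ B ∈ F, if R B ⊆ K then (1 : ℝ) else 0 := by
    intro K; simp [hX]
  have first : ∑ K ∈ powersetCard j V, X K = c * μ := by
    simp only [hXs]
    rw [Finset.sum_comm]
    have : ∀ B ∈ F, ∑ K ∈ powersetCard j V, (if R B ⊆ K then (1 : ℝ) else 0) = c * q := by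
      intro B hB
      rw [← card_filter_subset_eq (hR B hB) (hRa B hB) (by omega) hjn]
      simp
    rw [Finset.sum_congr rfl this, Finset.sum_const, nsmul_eq_mul, hμ]
    ring
  have second : ∑ K ∈ powersetCard j V, X K ^ 2 ≤ c * μ ^ 2 + Δ * (c * μ) := by
    have e : ∀ K, X K ^ 2 = ∑ B ∈ F, ∑ B' ∈ F, if R B ∪ R B' ⊆ K then (1 : ℝ) else 0 := by
      intro K
      rw [sq, hXs, Finset.sum_mul_sum]
      refine Finset.sum_congr rfl fun B _ => Finset.sum_congr rfl fun B' _ => ?_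
      by_cases h1 : R B ⊆ K <;> by_cases h2 : R B' ⊆ K <;> simp [h1, h2, union_subset_iff]
    simp only [e]
    rw [Finset.sum_comm]
    have h1 : ∀ B ∈ F, ∑ K ∈ powersetCard j V, ∑ B' ∈ F,
        (if R B ∪ R B' ⊆ K then (1 : ℝ) else 0) ≤ F.card * (c * q ^ 2) + Δ * (c * q) := by
      intro B hB
      rw [Finset.sum_comm]
      have h2 : ∀ B' ∈ F, ∑ K ∈ powersetCard j V,
          (if R B ∪ R B' ⊆ K then (1 : ℝ) else 0) ≤
          c * q ^ 2 + (if ¬ Disjoint (R B) (R B') then c * q else 0) := by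
        intro B' hB'
        by_cases hd : Disjoint (R B) (R B')
        · simp only [hd, not_true, if_false, add_zero]
          have h3 := card_filter_subset_eq (union_subset (hR B hB) (hR B' hB'))
            (a := a + a) (by rw [card_union_of_disjoint hd, hRa B hB, hRa B' hB']) hj hjn
          rw [Finset.sum_boole, h3]
          exact mul_le_mul_of_nonneg_left (inclProb_add_self_le hj hjn) hc0
        · simp only [hd, not_false_eq_true, if_true]
          have h3 := card_filter_subset_eq (hR B hB) (hRa B hB) (by omega) hjn
          rw [Finset.sum_boole]
          have h4 : (((powersetCard j V).filter (R B ∪ R B' ⊆ ·)).card : ℝ) ≤ c * q := by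
            rw [hc, hq, ← h3]
            exact_mod_cast card_le_card
              (monotone_filter_right _ fun K _ h => (union_subset_iff.1 h).1)
          have : 0 ≤ c * q ^ 2 := by positivity
          linarith
      refine (Finset.sum_le_sum h2).trans ?_
      rw [Finset.sum_add_distrib, Finset.sum_const, nsmul_eq_mul, ← Finset.sum_filter,
        Finset.sum_const, nsmul_eq_mul]
      gcongr
      exact hΔ B hB
    refine (Finset.sum_le_sum h1).trans (le_of_eq ?_)
    rw [Finset.sum_const, nsmul_eq_mul, hμ]
    ring
  have var : ∑ K ∈ powersetCard j V, (X K - μ) ^ 2 ≤ Δ * (c * μ) := by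
    have e : ∑ K ∈ powersetCard j V, (X K - μ) ^ 2 =
        ∑ K ∈ powersetCard j V, X K ^ 2 - 2 * μ * ∑ K ∈ powersetCard j V, X K + c * μ ^ 2 := by
      rw [Finset.mul_sum, ← Finset.sum_sub_distrib, hc, ← card_powersetCard, ← nsmul_eq_mul,
        ← Finset.sum_const, ← Finset.sum_add_distrib]
      exact Finset.sum_congr rfl fun K _ => by ring
    rw [e, first]
    linarith
  have hμ0 : 0 ≤ μ := by positivity
  rcases hμ0.eq_or_lt with h0 | h0
  · rw [← h0, mul_zero]; positivity
  · have mk : (((powersetCard j V).filter fun K => X K < μ / 2).card : ℝ) * (μ ^ 2 / 4) ≤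
        Δ * (c * μ) := by
      refine le_trans ?_ var
      rw [← nsmul_eq_mul]
      refine le_trans (Finset.card_nsmul_le_sum _ (fun K => (X K - μ) ^ 2) _ fun K hK => ?_)
        (Finset.sum_le_sum_of_subset_of_nonneg (filter_subset _ _) fun _ _ _ => sq_nonneg _)
      have := (mem_filter.1 hK).2
      nlinarith
    refine le_of_mul_le_mul_right ?_ h0
    linarith

theorem card_le_of_mem_apSet {k N : ℕ} {B : Finset ℕ} (hB : B ∈ apSet k N) : B.card ≤ k := by
  obtain ⟨-, a, b, -, -, rfl⟩ := mem_filter.1 hB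
  exact card_image_le.trans (card_range k).le

theorem card_apSet_pair_le (k N : ℕ) {x y : ℕ} (hxy : x ≠ y) :
    ((apSet k N).filter fun B => x ∈ B ∧ y ∈ B).card ≤ k ^ 2 := by
  have key : ∀ B ∈ (apSet k N).filter fun B => x ∈ B ∧ y ∈ B, ∃ c : ℕ × ℕ,
      c ∈ range k ×ˢ range k ∧ ∃ a b : ℕ, B = (Finset.range k).image (fun i => a + i * b) ∧
        x = a + c.1 * b ∧ y = a + c.2 * b := by
    intro B hB
    obtain ⟨hB, hx, hy⟩ := mem_filter.1 hB
    obtain ⟨-, a, b, -, -, rfl⟩ := mem_filter.1 hB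
    obtain ⟨i, hi, hix⟩ := mem_image.1 hx
    obtain ⟨i', hi', hiy⟩ := mem_image.1 hy
    exact ⟨(i, i'), mem_product.2 ⟨hi, hi'⟩, a, b, rfl, hix.symm, hiy.symm⟩
  choose! f hf hf' using key
  have hcard : k ^ 2 = (range k ×ˢ range k).card := by simp [sq]
  rw [hcard]
  refine card_le_card_of_injOn f hf fun B hB B' hB' h => ?_
  obtain ⟨a, b, e, hx, hy⟩ := hf' B hB
  obtain ⟨a', b', e', hx', hy'⟩ := hf' B' hB'
  rw [← h] at hx' hy'
  generalize f B = c at *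
  have hc : (c.1 : ℤ) - c.2 ≠ 0 := by
    intro h0
    have : c.1 = c.2 := by omega
    exact hxy (by rw [hx, hy, this])
  have hb : b = b' := by
    zify at hx hy hx' hy' ⊢
    refine mul_left_cancel₀ hc ?_
    linear_combination hx' - hy' - hx + hy
  subst hb
  have ha : a = a' := by omega
  rw [e, e', ha]

/-- The progressions through `u` meeting `U` in exactly `r` elements. -/
def apThrough (k N r : ℕ) (U : Finset ℕ) (u : ℕ) : Finset (Finset ℕ) :=
  (apSet k N).filter fun B => u ∈ B ∧ (B ∩ U).card = r

theorem discrete_derivative_le (k N r : ℕ) {U : Finset ℕ} {u : ℕ} (hu : u ∈ U) :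
    Ar k N r (insert u U) - Ar k N r (U.erase u) ≤ ((apThrough k N r U u).card : ℝ) := by
  rw [insert_eq_of_mem hu, sub_le_iff_le_add, Ar, Ar]
  norm_cast
  refine le_trans (card_le_card ?_) (card_union_le _ _)
  intro B hB
  simp only [mem_union, apThrough, mem_filter] at hB ⊢
  by_cases h : u ∈ B
  · exact Or.inl ⟨hB.1, h, hB.2⟩
  · refine Or.inr ⟨hB.1, ?_⟩
    rw [← hB.2, inter_erase, erase_eq_of_notMem]
    simp [h]

theorem sum_card_apThrough_le (k N a : ℕ) (G K : Finset ℕ) :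
    ∑ u ∈ G, ((apThrough k N a K u).card : ℝ) ≤ k * Ar k N a K := by
  have e : ∀ u, ((apThrough k N a K u).card : ℝ) =
      ∑ B ∈ (apSet k N).filter (fun B => (B ∩ K).card = a), if u ∈ B then (1 : ℝ) else 0 := by
    intro u
    rw [Finset.sum_boole, filter_filter, apThrough]
    simp only [and_comm]
  simp only [e]
  rw [Finset.sum_comm, Ar, mul_comm, ← nsmul_eq_mul]
  refine Finset.sum_le_card_nsmul _ _ _ fun B hB => ?_
  rw [Finset.sum_boole]
  have h1 : (G.filter (· ∈ B)).card ≤ B.card :=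
    card_le_card fun u hu => (mem_filter.1 hu).2
  exact_mod_cast h1.trans (card_le_of_mem_apSet (mem_filter.1 hB).1)

theorem card_apThrough_le (k N : ℕ) {r : ℕ} (hr : 2 ≤ r) {U : Finset ℕ} (u : ℕ) :
    (apThrough k N r U u).card ≤ k ^ 2 * U.card := by
  have hsub : apThrough k N r U u ⊆
      (U.erase u).biUnion fun y => (apSet k N).filter fun B => u ∈ B ∧ y ∈ B := by
    intro B hB
    obtain ⟨hB, hu, hc⟩ := mem_filter.1 hB
    obtain ⟨y, hy, hyu⟩ := Finset.exists_mem_ne (by omega : 1 < (B ∩ U).card) u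
    rw [mem_inter] at hy
    exact mem_biUnion.2 ⟨y, mem_erase.2 ⟨hyu, hy.2⟩, mem_filter.2 ⟨hB, hu, hy.1⟩⟩
  refine (card_le_card hsub).trans ((card_biUnion_le_card_mul _ _ (k ^ 2) ?_).trans ?_)
  · exact fun y hy => card_apSet_pair_le k N (ne_of_mem_erase hy).symm
  · rw [mul_comm]
    exact Nat.mul_le_mul_left _ (card_le_card (erase_subset _ _))

theorem card_meeting_traces_le (k N r : ℕ) (U : Finset ℕ) {u : ℕ} {B : Finset ℕ}
    (hB : B ∈ apThrough k N r U u) :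
    ((apThrough k N r U u).filter fun B' =>
      ¬ Disjoint ((B ∩ U).erase u) ((B' ∩ U).erase u)).card ≤ k ^ 3 := by
  have hsub : ((apThrough k N r U u).filter fun B' =>
      ¬ Disjoint ((B ∩ U).erase u) ((B' ∩ U).erase u)) ⊆
      (B.erase u).biUnion fun y => (apSet k N).filter fun B => u ∈ B ∧ y ∈ B := by
    intro B' hB'
    obtain ⟨hB', hd⟩ := mem_filter.1 hB'
    obtain ⟨hB', hu, -⟩ := mem_filter.1 hB'
    obtain ⟨y, hy, hy'⟩ := not_disjoint_iff.1 hd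
    simp only [mem_erase, mem_inter] at hy hy'
    exact mem_biUnion.2 ⟨y, mem_erase.2 ⟨hy.1, hy.2.1⟩, mem_filter.2 ⟨hB', hu, hy'.2.1⟩⟩
  refine (card_le_card hsub).trans ((card_biUnion_le_card_mul _ _ (k ^ 2) ?_).trans ?_)
  · exact fun y hy => card_apSet_pair_le k N (ne_of_mem_erase hy).symm
  · rw [pow_succ' k 2]
    refine Nat.mul_le_mul_right _ ((card_le_card (erase_subset _ _)).trans ?_)
    exact card_le_of_mem_apSet (mem_filter.1 hB).1

theorem card_filter_few_extensions_le {k N a : ℕ} (ha : 2 ≤ a) (hak : a ≤ k) {U : Finset ℕ}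
    {u : ℕ} (hu : u ∈ U) {j : ℕ} (hj : j < U.card) :
    (((powersetCard j (U.erase u)).filter fun K => ((apThrough k N a K u).card : ℝ) <
        (apThrough k N (a + 1) U u).card * (((j : ℝ) + 1) / (2 * U.card)) ^ a / 2).card : ℝ) *
      (apThrough k N (a + 1) U u).card ≤
      4 * (k : ℝ) ^ 3 * (2 * (U.card : ℝ) / ((j : ℝ) + 1)) ^ a *
        ((U.card - 1).choose j : ℝ) := by
  set F := apThrough k N (a + 1) U u with hF
  have hcard : (U.erase u).card = U.card - 1 := card_erase_of_mem hu
  have hs0 : (0 : ℝ) < U.card := by exact_mod_cast (by omega : 0 < U.card)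
  have hj0 : (0 : ℝ) < (j : ℝ) + 1 := by positivity
  rcases le_or_gt (a + a) j with h | h
  · have hjn : j ≤ (U.erase u).card := by omega
    have hRa : ∀ B ∈ F, ((B ∩ U).erase u).card = a := by
      intro B hB
      obtain ⟨_, hB1, hB2⟩ := mem_filter.1 hB
      rw [card_erase_of_mem (mem_inter.2 ⟨hB1, hu⟩), hB2]
      rfl
    have cheb := card_few_traces_le h hjn F (fun B => (B ∩ U).erase u)
      (fun B _ => erase_subset_erase _ inter_subset_right) hRa
      (Δ := (k : ℝ) ^ 3) (by positivity)
      (fun B hB => by exact_mod_cast card_meeting_traces_le k N (a + 1) U hB)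
    have hq := le_inclProb h hjn
    rw [hcard] at cheb hq
    have e : ((U.card - 1 : ℕ) : ℝ) + 1 = U.card := by
      rw [Nat.cast_sub (by omega)]; simp
    rw [e] at hq
    set q := inclProb (U.card - 1) j a
    set ρ := (((j : ℝ) + 1) / (2 * U.card)) ^ a with hρ
    have hρ0 : 0 < ρ := by positivity
    have hle : ((powersetCard j (U.erase u)).filter fun K =>
        ((apThrough k N a K u).card : ℝ) < F.card * ρ / 2).card ≤
        ((powersetCard j (U.erase u)).filter fun K =>
        ((F.filter fun B => (B ∩ U).erase u ⊆ K).card : ℝ) < F.card * q / 2).card := by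
      refine card_le_card fun K hK => ?_
      obtain ⟨hK, hlt⟩ := mem_filter.1 hK
      refine mem_filter.2 ⟨hK, ?_⟩
      have hKU := (mem_powersetCard.1 hK).1
      have h1 : (F.filter fun B => (B ∩ U).erase u ⊆ K).card ≤ (apThrough k N a K u).card := by
        refine card_le_card fun B hB => ?_
        obtain ⟨hB, hBK⟩ := mem_filter.1 hB
        have hc := hRa B hB
        obtain ⟨hB1, hB2, hB3⟩ := mem_filter.1 hB
        refine mem_filter.2 ⟨hB1, hB2, ?_⟩
        rw [← hc]
        congr 1
        ext y
        simp only [mem_inter, mem_erase]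
        constructor
        · rintro ⟨hy1, hy2⟩
          have := mem_erase.1 (hKU hy2)
          exact ⟨this.1, hy1, this.2⟩
        · rintro ⟨hy1, hy2, hy3⟩
          exact ⟨hy2, hBK (mem_erase.2 ⟨hy1, mem_inter.2 ⟨hy2, hy3⟩⟩)⟩
      have h2 : ((F.filter fun B => (B ∩ U).erase u ⊆ K).card : ℝ) ≤
        ((apThrough k N a K u).card : ℝ) := by exact_mod_cast h1
      have h3 : (F.card : ℝ) * ρ ≤ F.card * q := by gcongr
      linarith
    have hle' := (Nat.cast_le (α := ℝ)).2 hle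
    have e2 : (2 * (U.card : ℝ) / ((j : ℝ) + 1)) ^ a = ρ⁻¹ := by
      rw [hρ, ← inv_pow, inv_div]
    rw [e2]
    refine le_of_mul_le_mul_right ?_ hρ0
    calc _ = _ * ((F.card : ℝ) * ρ) := mul_assoc _ _ _
      _ ≤ _ * ((F.card : ℝ) * q) := by gcongr
      _ ≤ _ := cheb
      _ = _ := by field_simp
  · have h1 : ((powersetCard j (U.erase u)).filter fun K => ((apThrough k N a K u).card : ℝ) <
        F.card * (((j : ℝ) + 1) / (2 * U.card)) ^ a / 2).card ≤ (U.card - 1).choose j := by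
      rw [← hcard, ← card_powersetCard]
      exact card_filter_le _ _
    have h2 : (F.card : ℝ) ≤ (k : ℝ) ^ 2 * U.card := by
      exact_mod_cast card_apThrough_le k N (by omega) u
    have hk : (0 : ℝ) < k := by exact_mod_cast (by omega : 0 < k)
    have h3 : (1 : ℝ) ≤ 2 * (U.card : ℝ) / ((j : ℝ) + 1) := by
      rw [le_div_iff₀ hj0]
      have : (j : ℝ) + 1 ≤ U.card := by exact_mod_cast hj
      linarith
    have h4 : (U.card : ℝ) / k ≤ 2 * (U.card : ℝ) / ((j : ℝ) + 1) := by
      rw [div_le_div_iff₀ hk hj0]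
      have : (j : ℝ) + 1 ≤ 2 * k := by exact_mod_cast (by omega : j + 1 ≤ 2 * k)
      nlinarith
    have h5 : (U.card : ℝ) / k ≤ (2 * (U.card : ℝ) / ((j : ℝ) + 1)) ^ a :=
      h4.trans (le_self_pow₀ h3 (by omega))
    have h6 : (F.card : ℝ) ≤ 4 * (k : ℝ) ^ 3 * (2 * (U.card : ℝ) / ((j : ℝ) + 1)) ^ a := by
      calc (F.card : ℝ) ≤ (k : ℝ) ^ 2 * U.card := h2
        _ = (k : ℝ) ^ 3 * ((U.card : ℝ) / k) := by field_simp
        _ ≤ (k : ℝ) ^ 3 * (2 * (U.card : ℝ) / ((j : ℝ) + 1)) ^ a := by gcongr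
        _ ≤ _ := by
          have : 0 ≤ (k : ℝ) ^ 3 * (2 * (U.card : ℝ) / ((j : ℝ) + 1)) ^ a := by positivity
          linarith
    rw [mul_comm]
    exact mul_le_mul h6 (by exact_mod_cast h1) (by positivity) (by positivity)

/-- The constant in the bound for a single admissible extension. -/
def stepConst (k : ℕ) : ℝ := 4 * (k : ℝ) ^ 3 * 2 ^ k

theorem stepConst_pos {k : ℕ} (hk : 1 ≤ k) : 0 < stepConst k := by
  have : (0 : ℝ) < k := by exact_mod_cast hk
  unfold stepConst; positivity

theorem min_one_mul_pow_le {z : ℝ} (hz : 0 < z) (hz1 : z ≤ 1) {a k : ℕ} (ha : 2 ≤ a)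
    (hak : a + 1 ≤ k) {s : ℕ} (hs : 1 ≤ s) (j : ℕ) {x : ℝ}
    (hx : x = s * z ^ ((1 : ℝ) / ((k : ℝ) - 1))) :
    min 1 (z * ((s : ℝ) / ((j : ℝ) + 1)) ^ a) ≤
      4 * x ^ 2 * (1 / (x + j) - 1 / (x + (j + 1 : ℕ))) := by
  set y := z ^ ((1 : ℝ) / ((k : ℝ) - 1)) with hy
  have hs0 : (0 : ℝ) < s := by exact_mod_cast hs
  have hy0 : 0 < y := Real.rpow_pos_of_pos hz _
  have hk1 : (0 : ℝ) < (k : ℝ) - 1 := by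
    rw [sub_pos]; exact_mod_cast (by omega : 1 < k)
  have hy1 : y ≤ 1 := Real.rpow_le_one hz.le hz1 (by positivity)
  have hyz : y ^ (k - 1) = z := by
    rw [hy, ← Real.rpow_natCast, ← Real.rpow_mul hz.le, Nat.cast_sub (by omega), Nat.cast_one,
      one_div_mul_cancel hk1.ne', Real.rpow_one]
  have hza : z ≤ y ^ a := by
    rw [← hyz]; exact pow_le_pow_of_le_one hy0.le hy1 (by omega)
  have hx0 : 0 < x := by rw [hx]; positivity
  have hj0 : (0 : ℝ) < (j : ℝ) + 1 := by positivity
  have hj : (0 : ℝ) ≤ (j : ℝ) := by positivity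
  have e : 4 * x ^ 2 * (1 / (x + j) - 1 / (x + (j + 1 : ℕ))) =
      4 * x ^ 2 / ((x + j) * (x + j + 1)) := by
    push_cast
    have : x + j ≠ 0 := by positivity
    have : x + j + 1 ≠ 0 := by positivity
    have : x + (j + 1) ≠ 0 := by positivity
    field_simp
    ring
  rw [e, le_div_iff₀ (by positivity)]
  rcases le_or_gt ((j : ℝ) + 1) x with h | h
  · have : min 1 (z * ((s : ℝ) / ((j : ℝ) + 1)) ^ a) ≤ 1 := min_le_left _ _
    calc _ ≤ 1 * ((x + j) * (x + j + 1)) := by gcongr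
      _ ≤ _ := by nlinarith
  · set v := x / ((j : ℝ) + 1) with hv
    have hv0 : 0 ≤ v := by positivity
    have hv1 : v ≤ 1 := by rw [hv, div_le_one hj0]; exact h.le
    have h1 : z * ((s : ℝ) / ((j : ℝ) + 1)) ^ a ≤ v ^ 2 := by
      calc _ ≤ y ^ a * ((s : ℝ) / ((j : ℝ) + 1)) ^ a := by gcongr
        _ = v ^ a := by rw [← mul_pow, hv, hx]; congr 1; ring
        _ ≤ v ^ 2 := pow_le_pow_of_le_one hv0 hv1 ha
    calc _ ≤ v ^ 2 * ((x + j) * (x + j + 1)) := by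
            gcongr; exact (min_le_right _ _).trans h1
      _ ≤ v ^ 2 * (4 * ((j : ℝ) + 1) ^ 2) := mul_le_mul_of_nonneg_left (by nlinarith) (by positivity)
      _ = _ := by rw [hv]; field_simp

theorem sum_telescope_le {x : ℝ} (hx : 0 < x) (s : ℕ) :
    ∑ j ∈ range s, 4 * x ^ 2 * (1 / (x + j) - 1 / (x + (j + 1 : ℕ))) ≤ 4 * x := by
  rw [← Finset.mul_sum, Finset.sum_range_sub' (fun j : ℕ => 1 / (x + j))]
  have : 0 ≤ 1 / (x + s) := by positivity
  calc _ ≤ 4 * x ^ 2 * (1 / x) := by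
        refine mul_le_mul_of_nonneg_left ?_ (by positivity)
        simpa using this
    _ = _ := by field_simp

/-- The weight of extending the set `K` by the element `u`. -/
def extWeight (k N a : ℕ) (K : Finset ℕ) (u : ℕ) : ℝ :=
  1 / (2 * N) + ((apThrough k N a K u).card : ℝ) / (2 * k * Ar k N a K)

theorem Ar_nonneg (k N r : ℕ) (K : Finset ℕ) : 0 ≤ Ar k N r K := Nat.cast_nonneg _

theorem extWeight_ge (k N a : ℕ) (K : Finset ℕ) (u : ℕ) :
    1 / (2 * (N : ℝ)) ≤ extWeight k N a K u := by
  have := Ar_nonneg k N a K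
  have : 0 ≤ ((apThrough k N a K u).card : ℝ) / (2 * k * Ar k N a K) := by positivity
  unfold extWeight; linarith

theorem extWeight_pos {N : ℕ} (hN : 1 ≤ N) (k a : ℕ) (K : Finset ℕ) (u : ℕ) :
    0 < extWeight k N a K u := by
  have : (0 : ℝ) < N := by exact_mod_cast hN
  exact lt_of_lt_of_le (by positivity) (extWeight_ge k N a K u)

theorem sum_extWeight_le_one {k N : ℕ} (hN : 1 ≤ N) (hk : 1 ≤ k) (a : ℕ) (K : Finset ℕ) :
    ∑ u ∈ Finset.Icc 1 N, extWeight k N a K u ≤ 1 := by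
  have hN0 : (0 : ℝ) < N := by exact_mod_cast hN
  have hk0 : (0 : ℝ) < k := by exact_mod_cast hk
  simp only [extWeight]
  rw [Finset.sum_add_distrib, Finset.sum_const, Nat.card_Icc, nsmul_eq_mul, ← Finset.sum_div]
  have h1 : ((N + 1 - 1 : ℕ) : ℝ) * (1 / (2 * (N : ℝ))) = 1 / 2 := by
    rw [Nat.add_sub_cancel]; field_simp
  have h2 : (∑ u ∈ Finset.Icc 1 N, ((apThrough k N a K u).card : ℝ)) / (2 * k * Ar k N a K) ≤
      1 / 2 := by
    rcases (Ar_nonneg k N a K).eq_or_lt with h | h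
    · rw [← h]; simp
    · rw [div_le_iff₀ (by positivity)]
      linarith [sum_card_apThrough_le k N a (Finset.Icc 1 N) K]
  linarith only [h1, h2]

theorem extWeight_ge_of_many {k N a : ℕ} (hk : 1 ≤ k) (hak : a ≤ k) {K : Finset ℕ} {u : ℕ}
    {D ρ θ : ℝ} (hρ : 0 < ρ) (hD : 0 < D) (hθ : θ * Ar k N a K ≤ D)
    (hX : D * (ρ / 2) ^ a / 2 ≤ ((apThrough k N a K u).card : ℝ)) :
    θ * ρ ^ a / (4 * k * 2 ^ k) ≤ extWeight k N a K u := by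
  have hk0 : (0 : ℝ) < k := by exact_mod_cast hk
  have hX0 : (0 : ℝ) < ((apThrough k N a K u).card : ℝ) := lt_of_lt_of_le (by positivity) hX
  have hXA : ((apThrough k N a K u).card : ℝ) ≤ Ar k N a K := by
    rw [Ar]
    exact_mod_cast card_le_card (monotone_filter_right (apSet k N)
      fun B _ (h : u ∈ B ∧ (B ∩ K).card = a) => h.2)
  have hA : 0 < Ar k N a K := hX0.trans_le hXA
  have h1 : θ * ρ ^ a / (4 * k * 2 ^ k) ≤
      ((apThrough k N a K u).card : ℝ) / (2 * k * Ar k N a K) := by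
    rw [div_le_div_iff₀ (by positivity) (by positivity)]
    have h2 : (2 : ℝ) ^ a ≤ 2 ^ k := pow_le_pow_right₀ (by norm_num) hak
    rw [div_pow] at hX
    calc θ * ρ ^ a * (2 * k * Ar k N a K) = (θ * Ar k N a K) * (ρ ^ a * (2 * k)) := by ring
      _ ≤ D * (ρ ^ a * (2 * k)) := by gcongr
      _ = (D * (ρ ^ a / 2 ^ a) / 2) * (4 * k * 2 ^ a) := by field_simp; ring
      _ ≤ ((apThrough k N a K u).card : ℝ) * (4 * k * 2 ^ k) := by gcongr
  have : (0 : ℝ) ≤ 1 / (2 * (N : ℝ)) := by positivity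
  unfold extWeight; linarith

theorem sum_log_extWeight_ge {k N a : ℕ} (hN : 1 ≤ N) (ha : 2 ≤ a) (hak : a + 1 ≤ k)
    {U : Finset ℕ} {u : ℕ} (hu : u ∈ U) {s : ℕ} (hs : U.card = s) {j : ℕ} (hj : j < s)
    {ξ τ t z x h : ℝ} (hξ : 0 < ξ) (ht : 0 < t) (hτ : 0 < τ)
    (hz : z = stepConst k * s / (ξ * t)) (hz1 : z ≤ 1)
    (hx : x = s * z ^ ((1 : ℝ) / ((k : ℝ) - 1)))
    (hh : h = ξ * τ / (stepConst k * s)) (hh1 : h ≤ 1)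
    (hDt : ξ / s * t ≤ ((apThrough k N (a + 1) U u).card : ℝ))
    (hDA : ∀ K ⊆ U, ξ / s * τ * Ar k N a K ≤ ((apThrough k N (a + 1) U u).card : ℝ)) :
    ((s - 1).choose j : ℝ) * (Real.log (h * (((j : ℝ) + 1) / s) ^ a) -
      4 * x ^ 2 * (1 / (x + j) - 1 / (x + (j + 1 : ℕ))) * Real.log (2 * N)) ≤
      ∑ K ∈ powersetCard j (U.erase u), Real.log (extWeight k N a K u) := by
  subst hs
  have hk1 : 1 ≤ k := by omega
  have hk0 : (1 : ℝ) ≤ k := by exact_mod_cast hk1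
  have hκ := stepConst_pos hk1
  have hs0 : (0 : ℝ) < U.card := by exact_mod_cast (by omega : 0 < U.card)
  have hN0 : (1 : ℝ) ≤ N := by exact_mod_cast hN
  set D : ℝ := ((apThrough k N (a + 1) U u).card : ℝ) with hD
  have hD0 : 0 < D := lt_of_lt_of_le (by positivity) hDt
  set c : ℝ := ((U.card - 1).choose j : ℝ) with hc
  set ρ : ℝ := ((j : ℝ) + 1) / U.card with hρ
  have hρ0 : 0 < ρ := by positivity
  have hρ1 : ρ ≤ 1 := by
    rw [hρ, div_le_one hs0]; exact_mod_cast hj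
  have hh0 : 0 < h := by rw [hh]; positivity
  set g := h * ρ ^ a with hg
  have hg0 : 0 < g := by positivity
  have hg1 : g ≤ 1 := mul_le_one₀ hh1 (by positivity) (pow_le_one₀ hρ0.le hρ1)
  set bad : Finset ℕ → Prop := fun K => ((apThrough k N a K u).card : ℝ) <
        D * (((j : ℝ) + 1) / (2 * U.card)) ^ a / 2 with hbad
  set nb : ℝ := (((powersetCard j (U.erase u)).filter bad).card : ℝ) with hnb
  have hlog : 0 ≤ Real.log (2 * N) := Real.log_nonneg (by linarith)
  have hnbc : nb ≤ c := by
    rw [hnb, hc, ← card_erase_of_mem hu, ← card_powersetCard]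
    exact_mod_cast card_filter_le _ _
  have hc0 : 0 ≤ c := by positivity
  have hnb2 : nb ≤ c * (z * ((U.card : ℝ) / ((j : ℝ) + 1)) ^ a) := by
    have h1 := card_filter_few_extensions_le (k := k) (N := N) ha (by omega) hu
      (j := j) (by omega)
    have h2 : nb * (ξ / U.card * t) ≤
        4 * (k : ℝ) ^ 3 * (2 * (U.card : ℝ) / ((j : ℝ) + 1)) ^ a * c := by
      refine le_trans ?_ h1
      rw [hnb]
      gcongr
    have h3 : (2 : ℝ) ^ a ≤ 2 ^ k := pow_le_pow_right₀ (by norm_num) (by omega)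
    have h4 : nb * (ξ / U.card * t) ≤ stepConst k * ((U.card : ℝ) / ((j : ℝ) + 1)) ^ a * c := by
      refine h2.trans ?_
      rw [mul_div_assoc, mul_pow, stepConst]
      calc _ = 4 * (k : ℝ) ^ 3 * 2 ^ a * ((U.card : ℝ) / ((j : ℝ) + 1)) ^ a * c := by ring
        _ ≤ _ := by gcongr
    rw [← le_div_iff₀ (by positivity)] at h4
    refine h4.trans (le_of_eq ?_)
    rw [hz]
    field_simp
  have hnb3 : nb ≤ c * (4 * x ^ 2 * (1 / (x + j) - 1 / (x + (j + 1 : ℕ)))) := by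
    have hz0 : 0 < z := by rw [hz]; positivity
    have h1 := min_one_mul_pow_le hz0 hz1 ha hak (by omega : 1 ≤ U.card) j hx
    have h2 : nb ≤ c * min 1 (z * ((U.card : ℝ) / ((j : ℝ) + 1)) ^ a) := by
      rcases min_choice (1 : ℝ) (z * ((U.card : ℝ) / ((j : ℝ) + 1)) ^ a) with h | h <;> rw [h]
      · linarith
      · exact hnb2
    exact h2.trans (by gcongr)
  have hpt : ∀ K ∈ powersetCard j (U.erase u),
      Real.log g - (if bad K then Real.log (2 * N) else 0) ≤
        Real.log (extWeight k N a K u) := by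
    intro K hK
    by_cases hb : bad K
    · simp only [hb, if_true]
      have h1 : Real.log (1 / (2 * (N : ℝ))) ≤ Real.log (extWeight k N a K u) :=
        Real.log_le_log (by positivity) (extWeight_ge k N a K u)
      rw [one_div, Real.log_inv] at h1
      have := Real.log_nonpos hg0.le hg1
      linarith
    · simp only [hb, if_false, sub_zero]
      refine Real.log_le_log hg0 ?_
      have hX : D * (ρ / 2) ^ a / 2 ≤ ((apThrough k N a K u).card : ℝ) := by
        rw [hbad, not_lt] at hb
        rw [hρ, div_div, mul_comm (U.card : ℝ) 2]
        exact hb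
      have hKU : K ⊆ U := (mem_powersetCard.1 hK).1.trans (erase_subset _ _)
      refine le_trans ?_ (extWeight_ge_of_many hk1 (by omega) hρ0 hD0 (hDA K hKU) hX)
      rw [hg, hh, stepConst]
      have h3 : (1 : ℝ) ≤ (k : ℝ) ^ 2 := one_le_pow₀ hk0
      have : ξ * τ / (4 * (k : ℝ) ^ 3 * 2 ^ k * U.card) * ρ ^ a =
        (ξ / U.card * τ * ρ ^ a / (4 * k * 2 ^ k)) / (k : ℝ) ^ 2 := by field_simp
      rw [this]
      exact div_le_self (by positivity) h3
  refine le_trans ?_ (Finset.sum_le_sum hpt)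
  rw [Finset.sum_sub_distrib, Finset.sum_const, ← Finset.sum_filter, Finset.sum_const,
    nsmul_eq_mul, nsmul_eq_mul, card_powersetCard, card_erase_of_mem hu]
  have := mul_le_mul_of_nonneg_right hnb3 hlog
  linarith

theorem card_family_le {k N a : ℕ} (hN : 1 ≤ N) (ha : 2 ≤ a) (hak : a + 1 ≤ k) {s : ℕ}
    (hs : 1 ≤ s) {ξ τ t z : ℝ} (hξ : 0 < ξ) (ht : 0 < t) (hτ : 0 < τ)
    (hz : z = stepConst k * s / (ξ * t)) (hz1 : z ≤ 1) (hh1 : ξ * τ / (stepConst k * s) ≤ 1)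
    {𝒞 : Finset (Finset ℕ)} (h𝒞 : 𝒞 ⊆ powersetCard s (Finset.Icc 1 N))
    (hDt : ∀ U ∈ 𝒞, ∀ u ∈ U, ξ / s * t ≤ ((apThrough k N (a + 1) U u).card : ℝ))
    (hDA : ∀ U ∈ 𝒞, ∀ u ∈ U, ∀ K ⊆ U,
      ξ / s * τ * Ar k N a K ≤ ((apThrough k N (a + 1) U u).card : ℝ)) :
    (𝒞.card : ℝ) ≤ (Real.exp k * (stepConst k / (ξ * τ)) *
      (2 * (N : ℝ)) ^ (4 * z ^ ((1 : ℝ) / ((k : ℝ) - 1)))) ^ s := by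
  have hk1 : 1 ≤ k := by omega
  have hκ := stepConst_pos hk1
  have hs0 : (0 : ℝ) < s := by exact_mod_cast hs
  have hN0 : (1 : ℝ) ≤ N := by exact_mod_cast hN
  have hz0 : 0 < z := by rw [hz]; positivity
  set y := z ^ ((1 : ℝ) / ((k : ℝ) - 1)) with hy
  have hy0 : 0 < y := Real.rpow_pos_of_pos hz0 _
  set h := ξ * τ / (stepConst k * s) with hh
  have hh0 : 0 < h := by positivity
  have hlog : 0 ≤ Real.log (2 * N) := Real.log_nonneg (by linarith)
  set x : ℝ := s * y with hx
  have hx0 : 0 < x := by positivity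
  set l : ℕ → ℝ := fun j => Real.log (h * (((j : ℝ) + 1) / s) ^ a) -
      4 * x ^ 2 * (1 / (x + j) - 1 / (x + (j + 1 : ℕ))) * Real.log (2 * N) with hl
  have main := card_mul_exp_le_one (extWeight_pos hN k a) (sum_extWeight_le_one hN hk1 a) l h𝒞
    (by
      intro U hU j hj
      have hc := (mem_powersetCard.1 (h𝒞 hU)).2
      rw [mul_assoc, ← hc, ← nsmul_eq_mul, hc]
      rw [← hc]
      refine Finset.card_nsmul_le_sum _ _ _ fun u hu => ?_
      rw [hc]
      exact sum_log_extWeight_ge hN ha hak hu hc hj hξ ht hτ hz hz1 hx hh hh1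
        (hDt U hU u hu) (hDA U hU u hu))
  have hfac : (0 : ℝ) < (s.factorial : ℝ) := by positivity
  have hsum : Real.log (h ^ s * ((s.factorial : ℝ) / (s : ℝ) ^ s) ^ a) - 4 * x * Real.log (2 * N)
      ≤ ∑ j ∈ range s, l j := by
    rw [hl, Finset.sum_sub_distrib, ← Finset.sum_mul, ← Real.log_prod (fun j _ => by positivity)]
    have e : ∏ j ∈ range s, h * (((j : ℝ) + 1) / s) ^ a =
        h ^ s * ((s.factorial : ℝ) / (s : ℝ) ^ s) ^ a := by
      rw [Finset.prod_mul_distrib, Finset.prod_const, card_range, Finset.prod_pow,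
        Finset.prod_div_distrib, Finset.prod_const, card_range, ← Finset.prod_range_add_one_eq_factorial]
      push_cast
      rfl
    rw [e]
    gcongr
    exact sum_telescope_le hx0 s
  have hexp := Real.exp_le_exp.2 hsum
  rw [Real.exp_sub, Real.exp_log (by positivity)] at hexp
  have hW : Real.exp (4 * x * Real.log (2 * N)) = ((2 * (N : ℝ)) ^ (4 * y)) ^ s := by
    rw [Real.rpow_def_of_pos (by linarith), ← Real.exp_nat_mul, hx]
    congr 1; ring
  rw [hW] at hexp
  set W := (2 * (N : ℝ)) ^ (4 * y) with hWdef
  have hW0 : 0 < W := Real.rpow_pos_of_pos (by linarith) _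
  have hst : ((Real.exp 1) ^ s)⁻¹ ≤ (s.factorial : ℝ) / (s : ℝ) ^ s := by
    have := Real.pow_div_factorial_le_exp (s : ℝ) hs0.le s
    rw [← Real.exp_nat_mul, mul_one, inv_le_comm₀ (by positivity) (by positivity), inv_div]
    exact this
  have hq : (((Real.exp 1) ^ s)⁻¹) ^ k * (s : ℝ) ^ s * h ^ s / W ^ s ≤
      (s.factorial : ℝ) * Real.exp (∑ j ∈ range s, l j) := by
    refine le_trans ?_ (mul_le_mul_of_nonneg_left hexp hfac.le)
    rw [← mul_div_assoc]
    refine div_le_div_of_nonneg_right ?_ (by positivity)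
    have h1 : (((Real.exp 1) ^ s)⁻¹ : ℝ) ≤ 1 :=
      inv_le_one_of_one_le₀ (one_le_pow₀ (Real.one_le_exp (by norm_num)))
    calc (((Real.exp 1) ^ s)⁻¹) ^ k * (s : ℝ) ^ s * h ^ s
        ≤ (((Real.exp 1) ^ s)⁻¹) ^ (a + 1) * (s : ℝ) ^ s * h ^ s := by
          gcongr ?_ * _ * _
          exact pow_le_pow_of_le_one (by positivity) h1 hak
      _ ≤ ((s.factorial : ℝ) / (s : ℝ) ^ s) ^ (a + 1) * (s : ℝ) ^ s * h ^ s := by gcongr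
      _ = _ := by rw [pow_succ]; field_simp
  have hfin := (mul_le_mul_of_nonneg_left hq (Nat.cast_nonneg (α := ℝ) 𝒞.card)).trans main
  rw [← le_div_iff₀ (by positivity)] at hfin
  refine hfin.trans (le_of_eq ?_)
  have e1 : Real.exp k = Real.exp 1 ^ k := by rw [← Real.exp_nat_mul, mul_one]
  rw [e1, hh]
  simp only [mul_pow, div_pow, inv_pow, ← pow_mul]
  rw [mul_comm s k]
  field_simp

theorem core_degree {k N : ℕ} {t ε δ : ℝ} {m s : ℕ} {ξ τ : ℝ}
    (hξ : ξ = δ * betaFn ((s : ℝ) / (m : ℝ))) (hξ0 : 0 < ξ)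
    (hτ : τ = (t / (s : ℝ) ^ 2) ^ ((1 : ℝ) / ((k : ℝ) - 2))) (hτ0 : 0 < τ)
    {U : Finset ℕ} (hU : U ∈ coreFamily k N t ε δ m s) :
    U ∈ powersetCard s (Finset.Icc 1 N) ∧ ∃ a, 2 ≤ a ∧ a + 1 ≤ k ∧ ∀ u ∈ U,
      ξ / s * t ≤ ((apThrough k N (a + 1) U u).card : ℝ) ∧
      ∀ K ⊆ U, ξ / s * τ * Ar k N a K ≤ ((apThrough k N (a + 1) U u).card : ℝ) := by
  obtain ⟨hU1, hc, -, -, r, hr3, hrk, h⟩ := mem_filter.1 hU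
  refine ⟨mem_powersetCard.2 ⟨mem_powerset.1 hU1, hc⟩, r - 1, by omega, by omega,
    fun u hu => ?_⟩
  have h1 := (h u hu).trans (discrete_derivative_le k N r hu)
  rw [hc, ← hξ, ← hτ] at h1
  rw [show r - 1 + 1 = r by omega]
  have h2 : 0 ≤ ξ / s := by positivity
  refine ⟨(mul_le_mul_of_nonneg_left (le_max_left _ _) h2).trans h1, fun K hK => ?_⟩
  refine le_trans ?_ ((mul_le_mul_of_nonneg_left (le_max_right _ _) h2).trans h1)
  rw [mul_assoc]
  have h3 : Ar k N (r - 1) K ≤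
      U.powerset.sup' (Finset.powerset_nonempty U) (Ar k N (r - 1)) :=
    Finset.le_sup' (Ar k N (r - 1)) (mem_powerset.2 hK)
  gcongr

theorem core_size_bounds {k N a s : ℕ} (ha : 2 ≤ a) (hs : 1 ≤ s) {U : Finset ℕ}
    (hU : U.card = s) {ξ t : ℝ} (hξ : 0 < ξ) (ht : 0 < t)
    (hD : ∀ u ∈ U, ξ / s * t ≤ ((apThrough k N (a + 1) U u).card : ℝ)) :
    3 ≤ N ∧ ξ * t ≤ (k : ℝ) ^ 2 * (s : ℝ) ^ 2 := by
  have hs0 : (0 : ℝ) < s := by exact_mod_cast hs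
  obtain ⟨u, hu⟩ : U.Nonempty := Finset.card_pos.1 (by omega)
  have h1 := hD u hu
  constructor
  · have h2 : (0 : ℝ) < ((apThrough k N (a + 1) U u).card : ℝ) :=
      lt_of_lt_of_le (by positivity) h1
    obtain ⟨B, hB⟩ := Finset.card_pos.1 (Nat.cast_pos.1 h2)
    obtain ⟨hB, -, hBU⟩ := mem_filter.1 hB
    have h3 := card_le_card (mem_powerset.1 (mem_filter.1 hB).1)
    have h4 : (B ∩ U).card ≤ B.card := card_le_card inter_subset_left
    rw [Nat.card_Icc] at h3
    omega
  · have h2 : ((apThrough k N (a + 1) U u).card : ℝ) ≤ (k : ℝ) ^ 2 * s := by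
      rw [← hU]
      exact_mod_cast card_apThrough_le k N (by omega) u
    have h3 := h1.trans h2
    rw [div_mul_eq_mul_div, div_le_iff₀ hs0] at h3
    linarith

theorem rpow_le_of_le_of_one_le {q b e : ℝ} (hq : 0 ≤ q) (hqb : q ≤ b) (hb : 1 ≤ b)
    (he0 : 0 ≤ e) (he : e ≤ 1) : q ^ e ≤ b :=
  (Real.rpow_le_rpow hq hqb he0).trans
    ((Real.rpow_le_rpow_of_exponent_le hb he).trans (Real.rpow_one b).le)

theorem exponent_bounds {k : ℕ} (hk : 3 ≤ k) :
    0 < (1 : ℝ) / ((k : ℝ) - 2) ∧ (1 : ℝ) / ((k : ℝ) - 2) ≤ 1 ∧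
      0 < (1 : ℝ) / ((k : ℝ) - 1) ∧ (1 : ℝ) / ((k : ℝ) - 1) ≤ 1 := by
  have h : (3 : ℝ) ≤ k := by exact_mod_cast hk
  refine ⟨?_, ?_, ?_, ?_⟩
  · exact one_div_pos.2 (by linarith)
  · rw [div_le_one] <;> linarith
  · exact one_div_pos.2 (by linarith)
  · rw [div_le_one] <;> linarith

theorem card_coreFamily_le {k N : ℕ} (hk : 3 ≤ k) {t ε δ : ℝ} {m s : ℕ} (hs : 1 ≤ s)
    (ht : 0 < t) {ξ τ z : ℝ} (hξ : ξ = δ * betaFn ((s : ℝ) / (m : ℝ))) (hξ0 : 0 < ξ)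
    (hξ1 : ξ ≤ 1) (hτ : τ = (t / (s : ℝ) ^ 2) ^ ((1 : ℝ) / ((k : ℝ) - 2)))
    (hz : z = stepConst k * s / (ξ * t)) (hz1 : z ≤ 1)
    (hne : (coreFamily k N t ε δ m s).Nonempty) :
    (3 ≤ N ∧ ξ * t ≤ (k : ℝ) ^ 2 * (s : ℝ) ^ 2) ∧
    ((coreFamily k N t ε δ m s).card : ℝ) ≤
      (k * (Real.exp k * (stepConst k / (ξ * τ)) *
        (2 * (N : ℝ)) ^ (4 * z ^ ((1 : ℝ) / ((k : ℝ) - 1))))) ^ s := by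
  obtain ⟨he0, he1, -, -⟩ := exponent_bounds hk
  have hs1 : (1 : ℝ) ≤ s := by exact_mod_cast hs
  have hk3 : (3 : ℝ) ≤ k := by exact_mod_cast hk
  have hκ := stepConst_pos (by omega : 1 ≤ k)
  have hτ0 : 0 < τ := by rw [hτ]; positivity
  have core := fun U hU => core_degree (U := U) (ε := ε) (N := N) hξ hξ0 hτ hτ0 hU
  have bounds : 3 ≤ N ∧ ξ * t ≤ (k : ℝ) ^ 2 * (s : ℝ) ^ 2 := by
    obtain ⟨U, hU⟩ := hne
    obtain ⟨h1, a, ha, -, h2⟩ := core U hU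
    exact core_size_bounds ha hs (mem_powersetCard.1 h1).2 hξ0 ht fun u hu => (h2 u hu).1
  refine ⟨bounds, ?_⟩
  obtain ⟨hN3, hst⟩ := bounds
  have hh1 : ξ * τ / (stepConst k * s) ≤ 1 := by
    have h1 : τ ≤ (k : ℝ) ^ 2 / ξ := by
      rw [hτ]
      refine rpow_le_of_le_of_one_le (by positivity) ?_ ?_ he0.le he1
      · rw [div_le_div_iff₀ (by positivity) hξ0]; linarith
      · rw [le_div_iff₀ hξ0]; nlinarith
    rw [le_div_iff₀ hξ0] at h1
    rw [div_le_one (by positivity)]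
    have h2 : (1 : ℝ) ≤ 2 ^ k := one_le_pow₀ (by norm_num)
    calc ξ * τ ≤ (k : ℝ) ^ 2 := by linarith
      _ ≤ 4 * (k : ℝ) ^ 3 * 1 * 1 := by nlinarith [sq_nonneg (k : ℝ)]
      _ ≤ stepConst k * s := by unfold stepConst; gcongr
  set W := Real.exp k * (stepConst k / (ξ * τ)) *
        (2 * (N : ℝ)) ^ (4 * z ^ ((1 : ℝ) / ((k : ℝ) - 1))) with hW
  have hW0 : 0 ≤ W := by positivity
  set fam : ℕ → Finset (Finset ℕ) := fun a => (coreFamily k N t ε δ m s).filter fun U =>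
    ∀ u ∈ U, ξ / s * t ≤ ((apThrough k N (a + 1) U u).card : ℝ) ∧
      ∀ K ⊆ U, ξ / s * τ * Ar k N a K ≤ ((apThrough k N (a + 1) U u).card : ℝ) with hfam
  have hsub : coreFamily k N t ε δ m s ⊆ (Finset.Icc 2 (k - 1)).biUnion fam := by
    intro U hU
    obtain ⟨-, a, ha, hak, h⟩ := core U hU
    exact mem_biUnion.2 ⟨a, Finset.mem_Icc.2 ⟨ha, by omega⟩, mem_filter.2 ⟨hU, h⟩⟩
  have hcard : ∀ a ∈ Finset.Icc 2 (k - 1), ((fam a).card : ℝ) ≤ W ^ s := by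
    intro a ha
    rw [Finset.mem_Icc] at ha
    refine card_family_le (by omega) ha.1 (by omega) hs hξ0 ht hτ0 hz hz1 hh1 ?_ ?_ ?_
    · exact fun U hU => (core U (mem_filter.1 hU).1).1
    · exact fun U hU u hu => ((mem_filter.1 hU).2 u hu).1
    · exact fun U hU u hu => ((mem_filter.1 hU).2 u hu).2
  have h1 : ((coreFamily k N t ε δ m s).card : ℝ) ≤
      ∑ a ∈ Finset.Icc 2 (k - 1), ((fam a).card : ℝ) := by
    exact_mod_cast (card_le_card hsub).trans card_biUnion_le
  refine h1.trans ((Finset.sum_le_card_nsmul _ _ _ hcard).trans ?_)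
  rw [nsmul_eq_mul, mul_pow (k : ℝ) W, Nat.card_Icc]
  have h2 : ((k - 1 + 1 - 2 : ℕ) : ℝ) ≤ (k : ℝ) ^ s :=
    le_trans (by exact_mod_cast (by omega : k - 1 + 1 - 2 ≤ k))
      (le_self_pow₀ (by linarith) (by omega))
  exact mul_le_mul_of_nonneg_right h2 (by positivity)

theorem rpow_mul_two_sub_log_le {x θ : ℝ} (hx : 0 < x) (hx1 : x ≤ 1) (hθ : 0 < θ) :
    x ^ θ * (2 - Real.log x) ≤ 2 + 1 / θ := by
  have h1 := Real.log_le_rpow_div (inv_nonneg.2 hx.le) hθ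
  rw [Real.log_inv, Real.inv_rpow hx.le] at h1
  have h2 : x ^ θ ≤ 1 := Real.rpow_le_one hx.le hx1 hθ.le
  have h3 : 0 < x ^ θ := Real.rpow_pos_of_pos hx θ
  have h4 := mul_le_mul_of_nonneg_left h1 h3.le
  have h5 : x ^ θ * ((x ^ θ)⁻¹ / θ) = 1 / θ := by field_simp
  nlinarith

theorem mul_sq_two_sub_log_le {x : ℝ} (hx : 0 < x) (hx1 : x ≤ 1) :
    x * (2 - Real.log x) ^ 2 ≤ 16 := by
  have h := rpow_mul_two_sub_log_le hx hx1 (θ := 1 / 2) (by norm_num)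
  have h2 : x ^ ((1 : ℝ) / 2) * x ^ ((1 : ℝ) / 2) = x := by
    rw [← Real.rpow_add hx]; norm_num
  have h3 : 0 ≤ x ^ ((1 : ℝ) / 2) * (2 - Real.log x) :=
    mul_nonneg (by positivity) (by linarith [Real.log_nonpos hx.le hx1])
  calc x * (2 - Real.log x) ^ 2 = (x ^ ((1 : ℝ) / 2) * (2 - Real.log x)) ^ 2 := by
        rw [mul_pow, sq (x ^ ((1 : ℝ) / 2)), h2]
    _ ≤ (2 + 1 / (1 / 2)) ^ 2 := by gcongr
    _ = 16 := by norm_num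

theorem exists_poly_le_exp (A : ℝ) (hA : 0 < A) {η : ℝ} (hη : 0 < η) {k : ℕ} (hk : 1 ≤ k) :
    ∃ L₀ : ℝ, 1 ≤ L₀ ∧ ∀ L ≥ L₀,
      A * ((1 + 4 * k * L ^ 2) * (2 + k * L) ^ 2) ≤ Real.exp (η * L / 2) := by
  refine ⟨max 1 (5400 * A * (k : ℝ) ^ 3 * (2 / η) ^ 5), le_max_left _ _, fun L hL => ?_⟩
  have hk1 : (1 : ℝ) ≤ k := by exact_mod_cast hk
  have hL1 : 1 ≤ L := (le_max_left _ _).trans hL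
  have hL2 := (le_max_right _ _).trans hL
  have h1 : 1 + 4 * k * L ^ 2 ≤ 5 * k * L ^ 2 := by
    have : 1 ≤ (k : ℝ) * L ^ 2 := one_le_mul_of_one_le_of_one_le hk1 (one_le_pow₀ hL1)
    linarith
  have h2 : 2 + k * L ≤ 3 * k * L := by
    have : 1 ≤ (k : ℝ) * L := one_le_mul_of_one_le_of_one_le hk1 hL1
    linarith
  have h3 := Real.pow_div_factorial_le_exp (η * L / 2) (by positivity) 5
  refine le_trans ?_ h3
  calc A * ((1 + 4 * k * L ^ 2) * (2 + k * L) ^ 2)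
      ≤ A * ((5 * k * L ^ 2) * (3 * k * L) ^ 2) := by gcongr
    _ = (5400 * A * (k : ℝ) ^ 3 * (2 / η) ^ 5) * ((η / 2) ^ 5 * L ^ 4 / 120) := by
        field_simp; ring
    _ ≤ L * ((η / 2) ^ 5 * L ^ 4 / 120) := by gcongr
    _ = _ := by simp [Nat.factorial]; ring

theorem mul_log_le_of_sparse {k : ℕ} (hk : 3 ≤ k) {E η C N p L m t g : ℝ} (hE : 0 < E)
    (hη : 0 < η) (hC : (2 * E * (k : ℝ) ^ 2 / η) ^ (k - 1) ≤ C) (hN : 1 ≤ N) (hm : 0 < m)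
    (ht : 0 < t) (hp : 0 < p) (hL : L = Real.log (1 / p)) (hL1 : 1 ≤ L)
    (hgk : g ^ (k - 1) = m / t) (h1 : C * m ≤ t)
    (h2 : C * (m * N * p ^ (k - 1)) ≤ t) : E * g * Real.log N ≤ η * L / 2 := by
  have hk3 : (3 : ℝ) ≤ k := by exact_mod_cast hk
  set c := 2 * E * (k : ℝ) ^ 2 / η with hc
  have hc0 : 0 < c := by positivity
  have hC0 : 0 < C := lt_of_lt_of_le (by positivity) hC
  set M := Real.log N with hM
  have hM0 : 0 ≤ M := Real.log_nonneg hN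
  have hNM : N = Real.exp M := (Real.exp_log (by linarith)).symm
  have hpL : p = Real.exp (-L) := by
    rw [hL, one_div, Real.log_inv, neg_neg, Real.exp_log hp]
  have hEc : E / c = η / (2 * (k : ℝ) ^ 2) := by rw [hc]; field_simp
  have hk2 : (0 : ℝ) < (k : ℝ) ^ 2 := by positivity
  rcases le_or_gt M (k * L) with h | h
  · have hgc : g ≤ 1 / c := by
      refine le_of_pow_le_pow_left₀ (by omega : k - 1 ≠ 0) (by positivity) ?_
      rw [hgk, div_pow, one_pow, div_le_div_iff₀ ht (by positivity)]
      nlinarith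
    calc E * g * M ≤ E * (1 / c) * (k * L) := by gcongr
      _ = E / c * k * L := by ring
      _ = η * L / 2 * (1 / k) := by rw [hEc]; field_simp
      _ ≤ η * L / 2 * 1 := by
        gcongr
        rw [div_le_one (by positivity)]; linarith
      _ = _ := mul_one _
  · have hk1 : (0 : ℝ) < (k : ℝ) - 1 := by linarith
    have hcast : ((k - 1 : ℕ) : ℝ) = (k : ℝ) - 1 := by
      rw [Nat.cast_sub (by omega), Nat.cast_one]
    set θ : ℝ := 1 / (k * ((k : ℝ) - 1)) with hθ
    have hθ0 : 0 < θ := by positivity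
    have hgc : g ≤ Real.exp (-(θ * M)) / c := by
      refine le_of_pow_le_pow_left₀ (by omega : k - 1 ≠ 0) (by positivity) ?_
      rw [hgk, div_pow, ← Real.exp_nat_mul, hcast, div_le_div_iff₀ ht (by positivity)]
      have e : ((k : ℝ) - 1) * -(θ * M) = -(M / k) := by rw [hθ]; field_simp
      rw [e]
      have h3 : Real.exp (M / k) ≤ N * p ^ (k - 1) := by
        rw [hNM, hpL, ← Real.exp_nat_mul, ← Real.exp_add, hcast]
        refine Real.exp_le_exp.2 ?_
        have h4 : L ≤ M / k := by rw [le_div_iff₀ (by linarith)]; linarith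
        have h5 : M = k * (M / k) := by field_simp
        nlinarith
      have h6 : m * c ^ (k - 1) * Real.exp (M / k) ≤ t := by
        refine le_trans ?_ h2
        calc m * c ^ (k - 1) * Real.exp (M / k) ≤ m * C * (N * p ^ (k - 1)) := by gcongr
          _ = _ := by ring
      rw [Real.exp_neg, inv_mul_eq_div, le_div_iff₀ (Real.exp_pos _)]
      exact h6
    have h7 : M * Real.exp (-(θ * M)) ≤ 1 / θ := by
      rw [Real.exp_neg, ← div_eq_mul_inv, div_le_div_iff₀ (Real.exp_pos _) hθ0]
      linarith [Real.add_one_le_exp (θ * M)]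
    calc E * g * M ≤ E * (Real.exp (-(θ * M)) / c) * M := by gcongr
      _ = E / c * (M * Real.exp (-(θ * M))) := by ring
      _ ≤ E / c * (1 / θ) := by gcongr
      _ = η / 2 * (((k : ℝ) - 1) / k) := by rw [hEc, hθ]; field_simp
      _ ≤ η / 2 * 1 := by
        gcongr
        rw [div_le_one (by linarith)]; linarith
      _ ≤ η * L / 2 := by nlinarith

theorem card_coreFamily_le_of_le {k N : ℕ} (hk : 3 ≤ k) {t ε δ : ℝ} {m s : ℕ} (hs : 1 ≤ s)
    (hsm : s ≤ m) (hδ : 0 < δ) (hδ1 : δ ≤ 1) (ht : 0 < t) {l g : ℝ}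
    (hl : l = 2 - Real.log ((s : ℝ) / m)) (hg : g = ((m : ℝ) / t) ^ ((1 : ℝ) / ((k : ℝ) - 1)))
    (hmt : 16 * stepConst k / δ * m ≤ t) (hne : (coreFamily k N t ε δ m s).Nonempty) :
    3 ≤ N ∧ δ * t ≤ (k : ℝ) ^ 2 * (s : ℝ) ^ 2 * l ^ 2 ∧
    ((coreFamily k N t ε δ m s).card : ℝ) ≤
      (k * Real.exp k * stepConst k / δ *
        (l ^ 2 * ((s : ℝ) ^ 2 / t) ^ ((1 : ℝ) / ((k : ℝ) - 2))) *
        (N : ℝ) ^ (128 * stepConst k / δ * g)) ^ s := by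
  obtain ⟨-, -, he0, he1⟩ := exponent_bounds hk
  have hs0 : (0 : ℝ) < s := by exact_mod_cast hs
  have hm0 : (0 : ℝ) < m := by exact_mod_cast hs.trans hsm
  have hκ := stepConst_pos (by omega : 1 ≤ k)
  have hκ1 : 1 ≤ stepConst k := by
    have h1 : (1 : ℝ) ≤ k := by exact_mod_cast (by omega : 1 ≤ k)
    have h2 : (1 : ℝ) ≤ (k : ℝ) ^ 3 * 2 ^ k :=
      one_le_mul_of_one_le_of_one_le (one_le_pow₀ h1) (one_le_pow₀ (by norm_num))
    unfold stepConst
    linarith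
  have hx0 : (0 : ℝ) < (s : ℝ) / m := by positivity
  have hx1 : (s : ℝ) / m ≤ 1 := by
    rw [div_le_one hm0]; exact_mod_cast hsm
  have hl2 : 2 ≤ l := by linarith [Real.log_nonpos hx0.le hx1]
  have hl0 : 0 < l := by linarith
  obtain ⟨ξ, hξ⟩ : ∃ ξ, ξ = δ * betaFn ((s : ℝ) / m) := ⟨_, rfl⟩
  have hξl : ξ = δ / l ^ 2 := by rw [hξ, betaFn, hl, mul_one_div]
  have hξ0 : 0 < ξ := by rw [hξl]; positivity
  have hξ1 : ξ ≤ 1 := by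
    rw [hξl, div_le_one (by positivity)]; nlinarith
  have hxl : (s : ℝ) / m * l ^ 2 ≤ 16 := by rw [hl]; exact mul_sq_two_sub_log_le hx0 hx1
  set B := 16 * stepConst k / δ with hB
  have hB1 : 1 ≤ B := by rw [hB, le_div_iff₀ hδ]; linarith
  obtain ⟨z, hz⟩ : ∃ z, z = stepConst k * s / (ξ * t) := ⟨_, rfl⟩
  have hz0 : 0 ≤ z := by rw [hz]; positivity
  have hzB : z ≤ B * (m / t) := by
    calc z = stepConst k / δ * (m / t) * ((s : ℝ) / m * l ^ 2) := by
          rw [hz, hξl]; field_simp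
      _ ≤ stepConst k / δ * (m / t) * 16 := by gcongr
      _ = B * (m / t) := by rw [hB]; ring
  have hz1 : z ≤ 1 := by
    refine hzB.trans ?_
    rw [← mul_div_assoc, div_le_one ht]
    exact hmt
  have hy : z ^ ((1 : ℝ) / ((k : ℝ) - 1)) ≤ B * g := by
    refine (Real.rpow_le_rpow hz0 hzB he0.le).trans ?_
    rw [Real.mul_rpow (by positivity) (by positivity), ← hg]
    have : 0 ≤ g := by rw [hg]; positivity
    gcongr
    exact rpow_le_of_le_of_one_le (by positivity) le_rfl hB1 he0.le he1
  obtain ⟨⟨hN, hst⟩, hcard⟩ :=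
    card_coreFamily_le (ε := ε) (N := N) hk hs ht hξ hξ0 hξ1 rfl hz hz1 hne
  have hN3 : (3 : ℝ) ≤ N := by exact_mod_cast hN
  refine ⟨hN, ?_, hcard.trans ?_⟩
  · rw [hξl, div_mul_eq_mul_div, div_le_iff₀ (by positivity)] at hst
    exact hst
  · have h1 : (2 * (N : ℝ)) ^ (4 * z ^ ((1 : ℝ) / ((k : ℝ) - 1))) ≤
        (N : ℝ) ^ (128 * stepConst k / δ * g) := by
      calc (2 * (N : ℝ)) ^ (4 * z ^ ((1 : ℝ) / ((k : ℝ) - 1)))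
          ≤ ((N : ℝ) ^ (2 : ℝ)) ^ (4 * z ^ ((1 : ℝ) / ((k : ℝ) - 1))) := by
            gcongr
            rw [Real.rpow_two]; nlinarith
        _ = (N : ℝ) ^ (2 * (4 * z ^ ((1 : ℝ) / ((k : ℝ) - 1)))) := by
            rw [← Real.rpow_mul (by positivity)]
        _ ≤ (N : ℝ) ^ (128 * stepConst k / δ * g) := by
            refine Real.rpow_le_rpow_of_exponent_le (by linarith) ?_
            calc 2 * (4 * z ^ ((1 : ℝ) / ((k : ℝ) - 1))) ≤ 2 * (4 * (B * g)) := by gcongr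
              _ = _ := by rw [hB]; ring
    have h2 : ((s : ℝ) ^ 2 / t) ^ ((1 : ℝ) / ((k : ℝ) - 2)) =
        ((t / (s : ℝ) ^ 2) ^ ((1 : ℝ) / ((k : ℝ) - 2)))⁻¹ := by
      rw [← Real.inv_rpow (by positivity), inv_div]
    refine pow_le_pow_left₀ (by positivity) ?_ s
    calc k * (Real.exp k * (stepConst k / (ξ * (t / (s : ℝ) ^ 2) ^ ((1 : ℝ) / ((k : ℝ) - 2)))) *
          (2 * (N : ℝ)) ^ (4 * z ^ ((1 : ℝ) / ((k : ℝ) - 1))))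
        ≤ k * (Real.exp k * (stepConst k /
          (ξ * (t / (s : ℝ) ^ 2) ^ ((1 : ℝ) / ((k : ℝ) - 2)))) *
          (N : ℝ) ^ (128 * stepConst k / δ * g)) := by gcongr
      _ = _ := by
        rw [h2, hξl]
        field_simp

theorem sq_two_sub_log_mul_rpow_le {k : ℕ} (hk : 3 ≤ k) {s m t : ℝ} (hs : 0 < s)
    (hsm : s ≤ m) (ht : 0 < t) :
    (2 - Real.log (s / m)) ^ 2 * (s ^ 2 / t) ^ ((1 : ℝ) / ((k : ℝ) - 2)) ≤
      (k : ℝ) ^ 2 * (m ^ 2 / t) ^ ((1 : ℝ) / ((k : ℝ) - 2)) := by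
  obtain ⟨he0, -, -, -⟩ := exponent_bounds hk
  have hm : 0 < m := hs.trans_le hsm
  have hx0 : 0 < s / m := by positivity
  have hx1 : s / m ≤ 1 := (div_le_one hm).2 hsm
  have h1 := rpow_mul_two_sub_log_le hx0 hx1 he0
  rw [one_div_one_div] at h1
  have h2 : s ^ 2 / t = (s / m) ^ 2 * (m ^ 2 / t) := by field_simp
  set e := (1 : ℝ) / ((k : ℝ) - 2)
  have h0 : 0 ≤ (s / m) ^ e * (2 - Real.log (s / m)) :=
    mul_nonneg (by positivity) (by linarith [Real.log_nonpos hx0.le hx1])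
  have h3 : ((s / m) ^ 2) ^ e = ((s / m) ^ e) ^ 2 := by
    rw [← Real.rpow_natCast, ← Real.rpow_natCast, ← Real.rpow_mul hx0.le,
      ← Real.rpow_mul hx0.le, mul_comm]
  rw [h2, Real.mul_rpow (by positivity) (by positivity), h3]
  calc (2 - Real.log (s / m)) ^ 2 * (((s / m) ^ e) ^ 2 * (m ^ 2 / t) ^ e)
      = ((s / m) ^ e * (2 - Real.log (s / m))) ^ 2 * (m ^ 2 / t) ^ e := by ring
    _ ≤ (k : ℝ) ^ 2 * (m ^ 2 / t) ^ e := by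
      gcongr
      linarith

theorem rpow_inv_le_of_mul_pow_le {k : ℕ} (hk : 3 ≤ k) {m t y : ℝ} (hm : 0 < m) (ht : 0 < t)
    (hy : 0 < y) (h : m ^ 2 * y ^ (k - 2) ≤ t) :
    (m ^ 2 / t) ^ ((1 : ℝ) / ((k : ℝ) - 2)) ≤ y⁻¹ := by
  have h1 : m ^ 2 / t ≤ y⁻¹ ^ (k - 2) := by
    rw [inv_pow, div_le_iff₀ ht, inv_mul_eq_div, le_div_iff₀ (by positivity)]
    exact h
  obtain ⟨he0, -, -, -⟩ := exponent_bounds hk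
  refine (Real.rpow_le_rpow (by positivity) h1 he0.le).trans (le_of_eq ?_)
  have hc : ((k : ℝ) - 2) = ((k - 2 : ℕ) : ℝ) := by
    rw [Nat.cast_sub (by omega)]; norm_num
  rw [hc, one_div]
  exact Real.pow_rpow_inv_natCast (by positivity) (by omega)

theorem card_coreFamily_zero_le (k N : ℕ) (t ε δ : ℝ) (m : ℕ) :
    (coreFamily k N t ε δ m 0).card ≤ 1 := by
  refine card_le_one.2 fun U hU V hV => ?_
  rw [card_eq_zero.1 (mem_filter.1 hU).2.1, card_eq_zero.1 (mem_filter.1 hV).2.1]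

theorem two_sub_log_le {k : ℕ} (hk : 3 ≤ k) {δ s m t p L l : ℝ} (hs : 0 < s) (hm : 0 < m)
    (hδ : 0 < δ) (hp : 0 < p) (hL : L = Real.log (1 / p)) (hL0 : 0 ≤ L)
    (hl : l = 2 - Real.log (s / m)) (hsm : s ≤ m)
    (h1 : δ * t ≤ (k : ℝ) ^ 2 * s ^ 2 * l ^ 2)
    (h2 : 16 * (k : ℝ) ^ 2 / δ * (m ^ 2 * p ^ (k - 2)) ≤ t) : l ≤ 2 + k * L := by
  have hk0 : (0 : ℝ) < k := by exact_mod_cast (by omega : 0 < k)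
  have hx0 : 0 < s / m := by positivity
  have hx1 : s / m ≤ 1 := (div_le_one hm).2 hsm
  have hx := mul_sq_two_sub_log_le hx0 hx1
  rw [← hl] at hx
  have h3 : p ^ (k - 2) ≤ s / m := by
    rw [div_mul_eq_mul_div, div_le_iff₀ hδ] at h2
    have h4 : 16 * (k : ℝ) ^ 2 * m ^ 2 * p ^ (k - 2) ≤ 16 * (k : ℝ) ^ 2 * m ^ 2 * (s / m) := by
      calc 16 * (k : ℝ) ^ 2 * m ^ 2 * p ^ (k - 2) ≤ (k : ℝ) ^ 2 * s ^ 2 * l ^ 2 := by linarith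
        _ = (k : ℝ) ^ 2 * s * m * (s / m * l ^ 2) := by field_simp
        _ ≤ (k : ℝ) ^ 2 * s * m * 16 := by gcongr
        _ = _ := by field_simp
    exact le_of_mul_le_mul_left h4 (by positivity)
  have h4 := Real.log_le_log (by positivity) h3
  rw [Real.log_pow] at h4
  have h5 : L = -Real.log p := by rw [hL, one_div, Real.log_inv]
  have h6 : ((k - 2 : ℕ) : ℝ) * L ≤ k * L := by
    gcongr
    omega
  have h7 : ((k - 2 : ℕ) : ℝ) * L = -(((k - 2 : ℕ) : ℝ) * Real.log p) := by rw [h5]; ring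
  linarith

/-- **The number of cores of a given size** (Lemma 3.7). -/
theorem number_of_cores (ε δ η : ℝ) (hε : ε ∈ Set.Ioo (0 : ℝ) (1 / 2))
    (hδ : δ ∈ Set.Ioo (0 : ℝ) (1 / 2)) (hη : η ∈ Set.Ioo (0 : ℝ) (1 / 2))
    (k : ℕ) (hk : 3 ≤ k) :
    ∃ C > (0 : ℝ), ∀ N : ℕ, 1 ≤ N → ∀ p : ℝ, 0 < p → p < 1 / 2 →
      ∀ t m : ℕ, 1 ≤ t → 1 ≤ m →
        C * max (m : ℝ) (max ((m : ℝ) * (N : ℝ) * p ^ (k - 1))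
            ((m : ℝ) ^ 2 * p ^ (k - 2) *
              (N : ℝ) ^ (C * ((m : ℝ) / (t : ℝ)) ^ ((1 : ℝ) / ((k : ℝ) - 1))))) ≤ (t : ℝ) →
        ∀ s : ℕ,
          (s ≤ m → ((coreFamily k N (t : ℝ) ε δ m s).card : ℝ) ≤ (η / p) ^ s) ∧
          (s ≤ m → (s : ℝ) ≤ Real.sqrt (4 * (k : ℝ) * (t : ℝ)) * Real.log (1 / p) →
            ((coreFamily k N (t : ℝ) ε δ m s).card : ℝ) ≤ (1 / p) ^ (η * (s : ℝ))) := by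
  obtain ⟨hδ0, hδ2⟩ := hδ
  obtain ⟨hη0, hη2⟩ := hη
  have hk0 : (0 : ℝ) < k := by exact_mod_cast (by omega : 0 < k)
  have hκ := stepConst_pos (by omega : 1 ≤ k)
  obtain ⟨he0, he1, -, -⟩ := exponent_bounds hk
  set A := k * Real.exp k * stepConst k / δ with hA
  have hA0 : 0 < A := by positivity
  set E := 128 * stepConst k / δ with hE
  have hE0 : 0 < E := by positivity
  obtain ⟨L₀, hL₀1, hL₀⟩ := exists_poly_le_exp A hA0 hη0 (by omega : 1 ≤ k)
  set η₁ := min η (Real.exp (-L₀)) with hη₁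
  have hη₁0 : 0 < η₁ := lt_min hη0 (Real.exp_pos _)
  set G := A * (k : ℝ) ^ 2 / η₁ with hG
  have hG0 : 0 < G := by positivity
  set C₁ := E * k with hC₁
  set C₂ := 16 * stepConst k / δ with hC₂
  set C₃ := 16 * (k : ℝ) ^ 2 / δ with hC₃
  set C₄ := G ^ (k - 2) with hC₄
  set C₅ := (2 * E * (k : ℝ) ^ 2 / η) ^ (k - 1) with hC₅
  have h₁ : 0 < C₁ := by positivity
  have h₂ : 0 < C₂ := by positivity
  have h₃ : 0 < C₃ := by positivity
  have h₄ : 0 < C₄ := by positivity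
  have h₅ : 0 < C₅ := by positivity
  obtain ⟨C, hC⟩ : ∃ C, C = C₁ + C₂ + C₃ + C₄ + C₅ := ⟨_, rfl⟩
  have hC0 : 0 < C := by rw [hC]; positivity
  have hC₂C : C₂ ≤ C := by linarith only [hC, h₁, h₂, h₃, h₄, h₅]
  have hC₅C : C₅ ≤ C := by linarith only [hC, h₁, h₂, h₃, h₄, h₅]
  refine ⟨C, hC0, fun N hN p hp hp2 t m ht hm h s => ?_⟩
  have ht0 : (0 : ℝ) < t := by exact_mod_cast ht
  have hm0 : (0 : ℝ) < m := by exact_mod_cast hm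
  have hN1 : (1 : ℝ) ≤ N := by exact_mod_cast hN
  have hp1 : 1 ≤ 1 / p := by rw [le_div_iff₀ hp]; linarith
  rw [mul_max_of_nonneg _ _ hC0.le, mul_max_of_nonneg _ _ hC0.le, max_le_iff, max_le_iff] at h
  obtain ⟨hm1, hm2, hm3⟩ := h
  rcases Nat.eq_zero_or_pos s with rfl | hs
  · have h : ((coreFamily k N (t : ℝ) ε δ m 0).card : ℝ) ≤ 1 := by
      exact_mod_cast card_coreFamily_zero_le k N t ε δ m
    exact ⟨fun _ => by simpa using h, fun _ _ => by simpa using h⟩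
  rcases (coreFamily k N (t : ℝ) ε δ m s).eq_empty_or_nonempty with h | hne
  · rw [h, card_empty, Nat.cast_zero]
    exact ⟨fun _ => by positivity, fun _ _ => by positivity⟩
  have hs0 : (0 : ℝ) < s := by exact_mod_cast hs
  obtain ⟨g, hg⟩ : ∃ g, g = ((m : ℝ) / t) ^ ((1 : ℝ) / ((k : ℝ) - 1)) := ⟨_, rfl⟩
  have hg0 : 0 ≤ g := by rw [hg]; positivity
  rw [← hg] at hm3
  set n := (N : ℝ) ^ (E * g) with hn
  have hn0 : 0 < n := by positivity
  have main : ∀ hsm : s ≤ m, _ := fun hsm =>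
    card_coreFamily_le_of_le (ε := ε) (N := N) (δ := δ) hk hs hsm hδ0 (by linarith) ht0 rfl hg
      ((mul_le_mul_of_nonneg_right hC₂C hm0.le).trans hm1) hne
  have strong : s ≤ m → ((coreFamily k N (t : ℝ) ε δ m s).card : ℝ) ≤ (η₁ / p) ^ s := by
    intro hsm
    obtain ⟨-, -, h1⟩ := main hsm
    refine h1.trans (pow_le_pow_left₀ (by positivity) ?_ s)
    have hsm' : (s : ℝ) ≤ m := by exact_mod_cast hsm
    have h2 := sq_two_sub_log_mul_rpow_le hk hs0 hsm' ht0
    have h3 : (m : ℝ) ^ 2 * (G * p * n) ^ (k - 2) ≤ t := by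
      refine le_trans ?_ hm3
      have h4 : n ^ (k - 2) ≤ (N : ℝ) ^ (C * g) := by
        rw [hn, ← Real.rpow_natCast, ← Real.rpow_mul (by positivity)]
        refine Real.rpow_le_rpow_of_exponent_le hN1 ?_
        calc E * g * ((k - 2 : ℕ) : ℝ) ≤ E * g * k := by
              gcongr
              omega
          _ = C₁ * g := by rw [hC₁]; ring
          _ ≤ C * g := by
              gcongr
              linarith only [hC, h₁, h₂, h₃, h₄, h₅]
      calc (m : ℝ) ^ 2 * (G * p * n) ^ (k - 2)
          = C₄ * ((m : ℝ) ^ 2 * p ^ (k - 2) * n ^ (k - 2)) := by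
            rw [mul_pow, mul_pow, hC₄]; ring
        _ ≤ C * ((m : ℝ) ^ 2 * p ^ (k - 2) * (N : ℝ) ^ (C * g)) := by
            gcongr
            linarith only [hC, h₁, h₂, h₃, h₄, h₅]
    have h4 := rpow_inv_le_of_mul_pow_le hk hm0 ht0 (by positivity) h3
    calc A * ((2 - Real.log ((s : ℝ) / m)) ^ 2 *
          ((s : ℝ) ^ 2 / t) ^ ((1 : ℝ) / ((k : ℝ) - 2))) * n
        ≤ A * ((k : ℝ) ^ 2 * ((m : ℝ) ^ 2 / t) ^ ((1 : ℝ) / ((k : ℝ) - 2))) * n := by gcongr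
      _ ≤ A * ((k : ℝ) ^ 2 * (G * p * n)⁻¹) * n := by gcongr
      _ = η₁ / p := by rw [hG]; field_simp
  refine ⟨fun hsm => (strong hsm).trans ?_, fun hsm hsL => ?_⟩
  · gcongr
    exact min_le_left _ _
  rcases le_or_gt (Real.exp (-L₀)) p with hpL | hpL
  · refine (strong hsm).trans ((pow_le_one₀ (by positivity) ?_).trans
      (Real.one_le_rpow hp1 (by positivity)))
    rw [div_le_one hp]
    exact (min_le_right _ _).trans hpL
  obtain ⟨L, hL⟩ : ∃ L, L = Real.log (1 / p) := ⟨_, rfl⟩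
  have hLL : L₀ ≤ L := by
    have h1 := Real.log_le_log hp hpL.le
    rw [Real.log_exp] at h1
    rw [hL, one_div, Real.log_inv]
    linarith
  have hL1 : 1 ≤ L := hL₀1.trans hLL
  obtain ⟨hN3, h1, h2⟩ := main hsm
  have hsm' : (s : ℝ) ≤ m := by exact_mod_cast hsm
  have hl : 2 - Real.log ((s : ℝ) / m) ≤ 2 + k * L := by
    refine two_sub_log_le hk hs0 hm0 hδ0 hp hL (by linarith) rfl hsm' h1 (le_trans ?_ hm3)
    have h3 : 1 ≤ (N : ℝ) ^ (C * g) := Real.one_le_rpow hN1 (by positivity)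
    calc C₃ * ((m : ℝ) ^ 2 * p ^ (k - 2)) ≤ C * ((m : ℝ) ^ 2 * p ^ (k - 2)) := by
          gcongr
          linarith only [hC, h₁, h₂, h₃, h₄, h₅]
      _ = C * ((m : ℝ) ^ 2 * p ^ (k - 2) * 1) := by ring
      _ ≤ _ := by gcongr
  have hl0 : 0 ≤ 2 - Real.log ((s : ℝ) / m) := by
    linarith [Real.log_nonpos (by positivity) ((div_le_one hm0).2 hsm')]
  have hq : ((s : ℝ) ^ 2 / t) ^ ((1 : ℝ) / ((k : ℝ) - 2)) ≤ 1 + 4 * k * L ^ 2 := by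
    have h3 : (s : ℝ) ^ 2 ≤ 4 * k * t * L ^ 2 := by
      rw [← hL] at hsL
      have h4 := pow_le_pow_left₀ hs0.le hsL 2
      rwa [mul_pow, Real.sq_sqrt (by positivity)] at h4
    have h5 : 0 ≤ 4 * k * L ^ 2 := by positivity
    refine rpow_le_of_le_of_one_le (by positivity) ?_ (by linarith) he0.le he1
    rw [div_le_iff₀ ht0, one_add_mul]
    linarith only [h3, ht0]
  have hgk : g ^ (k - 1) = (m : ℝ) / t := by
    have hc : ((k : ℝ) - 1) = ((k - 1 : ℕ) : ℝ) := by
      rw [Nat.cast_sub (by omega), Nat.cast_one]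
    rw [hg, hc, one_div]
    exact Real.rpow_inv_natCast_pow (by positivity) (by omega)
  have hnexp : n ≤ Real.exp (η * L / 2) := by
    rw [hn, Real.rpow_def_of_pos (by linarith), Real.exp_le_exp, mul_comm]
    exact mul_log_le_of_sparse hk hE0 hη0 hC₅C hN1 hm0 ht0 hp hL hL1
      hgk hm1 hm2
  have hbase : A * ((2 - Real.log ((s : ℝ) / m)) ^ 2 *
      ((s : ℝ) ^ 2 / t) ^ ((1 : ℝ) / ((k : ℝ) - 2))) * n ≤ (1 / p) ^ η := by
    calc A * ((2 - Real.log ((s : ℝ) / m)) ^ 2 *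
          ((s : ℝ) ^ 2 / t) ^ ((1 : ℝ) / ((k : ℝ) - 2))) * n
        ≤ A * ((2 + k * L) ^ 2 * (1 + 4 * k * L ^ 2)) * Real.exp (η * L / 2) := by gcongr
      _ = A * ((1 + 4 * k * L ^ 2) * (2 + k * L) ^ 2) * Real.exp (η * L / 2) := by ring
      _ ≤ Real.exp (η * L / 2) * Real.exp (η * L / 2) := by
        gcongr
        exact hL₀ L hLL
      _ = (1 / p) ^ η := by
        rw [← Real.exp_add, Real.rpow_def_of_pos (by positivity), ← hL]
        congr 1
        ring
  refine h2.trans ((pow_le_pow_left₀ (by positivity) hbase s).trans (le_of_eq ?_))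
  rw [← Real.rpow_natCast, ← Real.rpow_mul (by positivity)]
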